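/- arXiv:2007.01366 — 2 statements merged into one kernel-verified Lean document; each statement's English description precedes it below -/
import Mathlib

section
/- Let n ≥ 1 and let ρ : SL(2,ℤ) → GL(V) be an irreducible representation on a finite-dimensional complex vector space such that the kernel of ρ contains the principal congruence subgroup Γ(n) and ρ(T) has multiplicative order exactly n. Suppose ρ is minimal, i.e. dim V = φ₂(n), the number of squares in (ℤ/nℤ)ˣ, and the set of eigenvalues of ρ(T) equals {ζ^{a²} : a an integer coprime to n} for some primitive n-th root of unity ζ. Then n = d·p₁⋯pℓ where d divides 12 and p₁,…,pℓ are distinct primes greater than 3; equivalently, 8 does not divide n, 9 does not divide n, and p² does not divide n for every prime p > 3. -/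
/-- `phi2 n` is the number of squares in the unit group `(ℤ/nℤ)ˣ`. -/
noncomputable def phi2 (n : ℕ) : ℕ := Nat.card (Set.range fun a : (ZMod n)ˣ => a ^ 2)

/-- Elements of `SL(2,ℤ)` with the same reduction mod `n` have the same image under a
homomorphism whose kernel contains `Γ(n)`. -/
lemma map_eq_of_reduction_eq {n : ℕ} {G : Type*} [Group G]
    {ρ : Matrix.SpecialLinearGroup (Fin 2) ℤ →* G}
    (hker : CongruenceSubgroup.Gamma n ≤ ρ.ker) {g h : Matrix.SpecialLinearGroup (Fin 2) ℤ}
    (H : (g : Matrix (Fin 2) (Fin 2) ℤ).map (Int.castRingHom (ZMod n)) =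
      (h : Matrix (Fin 2) (Fin 2) ℤ).map (Int.castRingHom (ZMod n))) :
    ρ g = ρ h := by
  have h1 : g * h⁻¹ ∈ CongruenceSubgroup.Gamma n := by
    rw [CongruenceSubgroup.Gamma, MonoidHom.mem_ker, map_mul, map_inv, mul_inv_eq_one]
    exact Subtype.ext H
  have h2 := hker h1
  rwa [MonoidHom.mem_ker, map_mul, map_inv, mul_inv_eq_one] at h2

lemma one_add_smul_mul_one_add_smul {R A : Type*} [CommRing R] [Ring A] [Algebra R A] {q : R}
    (hq : q * q = 0) (M N : A) : (1 + q • M) * (1 + q • N) = 1 + q • (M + N) := by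
  have h : (q • M) * (q • N) = 0 := by rw [smul_mul_smul_comm, hq, zero_smul]
  rw [mul_add, add_mul, add_mul, h, smul_add]
  simp only [mul_one, one_mul]
  abel

lemma one_add_smul_pow {R A : Type*} [CommRing R] [Ring A] [Algebra R A] {q : R}
    (hq : q * q = 0) (M : A) (k : ℕ) : (1 + q • M) ^ k = 1 + q • ((k : R) • M) := by
  induction k with
  | zero => simp
  | succ k ih =>
    rw [pow_succ, ih, one_add_smul_mul_one_add_smul hq, Nat.cast_succ, add_smul, one_smul]

/-- A nonzero subspace invariant under `f` contains an eigenvector of `f`. -/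
lemma exists_eigenvector_mem {V : Type*} [AddCommGroup V] [Module ℂ V] [FiniteDimensional ℂ V]
    (f : V →ₗ[ℂ] V) (W : Submodule ℂ V) (hW : ∀ x ∈ W, f x ∈ W) {x : V} (hx : x ∈ W)
    (hx0 : x ≠ 0) : ∃ y ∈ W, y ≠ 0 ∧ ∃ μ : ℂ, f y = μ • y := by
  have : Nontrivial W := ⟨⟨⟨x, hx⟩, 0, fun h => hx0 (congrArg Subtype.val h)⟩⟩
  obtain ⟨μ, hμ⟩ := Module.End.exists_eigenvalue (LinearMap.restrict f hW)
  obtain ⟨y, hy⟩ := hμ.exists_hasEigenvector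
  refine ⟨y, y.2, fun h => hy.2 (Subtype.ext h), μ, ?_⟩
  exact congrArg Subtype.val hy.apply_eq_smul

lemma exists_common_eigenvector {V : Type*} [AddCommGroup V] [Module ℂ V]
    [FiniteDimensional ℂ V] [Nontrivial V] (f g h : Module.End ℂ V)
    (hfg : Commute f g) (hfh : Commute f h) (hgh : Commute g h) :
    ∃ x : V, x ≠ 0 ∧ ∃ α β γ : ℂ, f x = α • x ∧ g x = β • x ∧ h x = γ • x := by
  have comm : ∀ {u v : Module.End ℂ V}, Commute u v → ∀ x, u (v x) = v (u x) :=
    fun H x => LinearMap.congr_fun H.eq x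
  obtain ⟨x₀, hx₀⟩ := exists_ne (0 : V)
  obtain ⟨x, -, hx, α, hα⟩ := exists_eigenvector_mem f ⊤ (fun _ _ => trivial) trivial hx₀
  obtain ⟨y, hyα, hy, β, hβ⟩ := exists_eigenvector_mem g (Module.End.eigenspace f α)
    (fun z hz => by
      rw [Module.End.mem_eigenspace_iff] at hz ⊢
      rw [comm hfg, hz, map_smul]) (Module.End.mem_eigenspace_iff.2 hα) hx
  obtain ⟨z, hzαβ, hz, γ, hγ⟩ := exists_eigenvector_mem h
    (Module.End.eigenspace f α ⊓ Module.End.eigenspace g β)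
    (fun z hz => by
      rw [Submodule.mem_inf, Module.End.mem_eigenspace_iff, Module.End.mem_eigenspace_iff] at hz ⊢
      rw [comm hfh, comm hgh, hz.1, hz.2, map_smul, map_smul]; exact ⟨rfl, rfl⟩)
    ⟨hyα, Module.End.mem_eigenspace_iff.2 hβ⟩ hy
  exact ⟨z, hz, α, β, γ, Module.End.mem_eigenspace_iff.1 hzαβ.1,
    Module.End.mem_eigenspace_iff.1 hzαβ.2, hγ⟩

/-- Over `ℤ/pℤ` with `p` odd, `a²x² + ex + f` with `a ≠ 0` does not take only nonzero square
values. -/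
lemma exists_not_nonzero_square {p : ℕ} [Fact p.Prime] (hp : p ≠ 2) {a : ZMod p} (ha : a ≠ 0)
    (e f : ZMod p) (H : ∀ x : ZMod p, ∃ d, d ≠ 0 ∧ d ^ 2 = a ^ 2 * x ^ 2 + e * x + f) : False := by
  have h2 : (2 : ZMod p) ≠ 0 := Ring.two_ne_zero (by rwa [ZMod.ringChar_zmod_n])
  obtain ⟨δ, hδ⟩ : ∃ δ : ZMod p, ∀ y, ∃ d, d ≠ 0 ∧ d ^ 2 = y ^ 2 + δ := by
    refine ⟨f - (e / (2 * a)) ^ 2, fun y => ?_⟩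
    obtain ⟨d, hd, h⟩ := H ((y - e / (2 * a)) / a)
    refine ⟨d, hd, h.trans ?_⟩
    field_simp
    ring
  have key : ∀ k : ℕ, ∃ y : ZMod p, y ^ 2 = k * δ := by
    intro k
    induction k with
    | zero => exact ⟨0, by simp⟩
    | succ k ih =>
      obtain ⟨y, hy⟩ := ih
      obtain ⟨d, -, h⟩ := hδ y
      exact ⟨d, by rw [h, hy]; push_cast; ring⟩
  obtain ⟨y, hy⟩ := key (p - 1)
  obtain ⟨d, hd, h⟩ := hδ y
  rw [hy, Nat.cast_sub (Fact.out : p.Prime).one_le] at h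
  simp at h
  exact hd h

section Level

variable {n : ℕ} {V : Type*} [AddCommGroup V] [Module ℂ V] [FiniteDimensional ℂ V]
  {ρ : Matrix.SpecialLinearGroup (Fin 2) ℤ →* (V →ₗ[ℂ] V)ˣ} {ζ : ℂ}

/-- The eigenvalues of a conjugate of `ρ(T)^k` are `k`-th powers of eigenvalues of `ρ(T)`. -/
lemma eigenvalue_conj_T_pow
    (hspec : {μ : ℂ | ∃ x : V, x ≠ 0 ∧ (ρ ModularGroup.T : V →ₗ[ℂ] V) x = μ • x}
      = {μ : ℂ | ∃ a : ℤ, IsCoprime a (n : ℤ) ∧ μ = ζ ^ (a ^ 2)})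
    (g : Matrix.SpecialLinearGroup (Fin 2) ℤ) (k : ℕ) {x : V} (hx : x ≠ 0) {μ : ℂ}
    (h : (ρ (g * ModularGroup.T ^ k * g⁻¹) : V →ₗ[ℂ] V) x = μ • x) :
    ∃ a : ℤ, IsCoprime a (n : ℤ) ∧ μ = (ζ ^ k) ^ (a ^ 2) := by
  set t : Module.End ℂ V := (ρ ModularGroup.T : V →ₗ[ℂ] V) with ht
  set y : V := (ρ g⁻¹ : V →ₗ[ℂ] V) x with hy
  have hgy : (ρ g : V →ₗ[ℂ] V) y = x := by
    rw [hy, ← Module.End.mul_apply, ← Units.val_mul, ← map_mul, mul_inv_cancel, map_one]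
    rfl
  have hy0 : y ≠ 0 := by
    intro h0
    rw [h0, map_zero] at hgy
    exact hx hgy.symm
  have hty : (t ^ k) y = μ • y := by
    have e : t ^ k = (ρ (g⁻¹ * (g * ModularGroup.T ^ k * g⁻¹) * g) : V →ₗ[ℂ] V) := by
      rw [ht, ← Units.val_pow_eq_pow_val, ← map_pow]
      congr 2
      group
    rw [e, map_mul, map_mul, Units.val_mul, Units.val_mul, Module.End.mul_apply,
      Module.End.mul_apply, hgy, h, map_smul]
  obtain ⟨z, hz, hz0, ν, hν⟩ := exists_eigenvector_mem t (Module.End.eigenspace (t ^ k) μ)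
    (fun w hw => by
      rw [Module.End.mem_eigenspace_iff] at hw ⊢
      rw [← Module.End.mul_apply, ← pow_succ, pow_succ', Module.End.mul_apply, hw, map_smul])
    (Module.End.mem_eigenspace_iff.2 hty) hy0
  have hpow : (t ^ k) z = ν ^ k • z :=
    Module.End.HasEigenvector.pow_apply ⟨Module.End.mem_eigenspace_iff.2 hν, hz0⟩ k
  rw [Module.End.mem_eigenspace_iff] at hz
  have hμ : μ = ν ^ k := smul_left_injective ℂ hz0 (hz.symm.trans hpow)
  have hmem : ν ∈ {μ : ℂ | ∃ x : V, x ≠ 0 ∧ (ρ ModularGroup.T : V →ₗ[ℂ] V) x = μ • x} :=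
    ⟨z, hz0, hν⟩
  rw [hspec] at hmem
  obtain ⟨a, ha, rfl⟩ := hmem
  refine ⟨a, ha, hμ.trans ?_⟩
  rw [← zpow_natCast, ← zpow_natCast, ← zpow_mul, ← zpow_mul, mul_comm]

/-- If `n = q r` with `r ∣ q`, a joint eigenvector of the abelian group `Γ(q)/Γ(n)` yields a binary
quadratic form mod `r` whose values are squares of units. -/
lemma exists_quadratic_form [Nontrivial V] {q r : ℕ} (hn : n = q * r) (hr : r ∣ q) (hq : 0 < q)
    (hr0 : r ≠ 0)
    (hker : CongruenceSubgroup.Gamma n ≤ ρ.ker) (hζ : IsPrimitiveRoot ζ n)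
    (hspec : {μ : ℂ | ∃ x : V, x ≠ 0 ∧ (ρ ModularGroup.T : V →ₗ[ℂ] V) x = μ • x}
      = {μ : ℂ | ∃ a : ℤ, IsCoprime a (n : ℤ) ∧ μ = ζ ^ (a ^ 2)}) :
    ∃ a b c : ℤ, IsCoprime a (r : ℤ) ∧ IsCoprime b (r : ℤ) ∧ IsCoprime c (r : ℤ) ∧
      ∀ x : ℕ, ∃ d : ℤ, IsCoprime d (r : ℤ) ∧
        (r : ℤ) ∣ (d ^ 2 + x * b ^ 2 + x * a ^ 2) - (x ^ 2 * a ^ 2 + b ^ 2 + x * c ^ 2) := by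
  have hω : IsPrimitiveRoot (ζ ^ q) r := hζ.pow (hn ▸ by positivity) hn
  have hω0 : ζ ^ q ≠ 0 := hω.ne_zero hr0
  have hcop : ∀ {a : ℤ}, IsCoprime a (n : ℤ) → IsCoprime a (r : ℤ) := fun h =>
    h.of_isCoprime_of_dvd_right (by rw [hn]; push_cast; exact dvd_mul_left _ _)
  have hqq : (q : ZMod n) * q = 0 := by
    rw [← Nat.cast_mul, ZMod.natCast_eq_zero_iff, hn]
    exact mul_dvd_mul_left q hr
  let G : Matrix.SpecialLinearGroup (Fin 2) ℤ → Matrix.SpecialLinearGroup (Fin 2) ℤ :=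
    fun g => g * ModularGroup.T ^ q * g⁻¹
  let red : Matrix.SpecialLinearGroup (Fin 2) ℤ →* Matrix (Fin 2) (Fin 2) (ZMod n) :=
    { toFun := fun g => (g : Matrix (Fin 2) (Fin 2) ℤ).map (Int.castRingHom (ZMod n))
      map_one' := by simp
      map_mul' := fun g h => by
        rw [Matrix.SpecialLinearGroup.coe_mul, Matrix.map_mul] }
  have hT : ((ModularGroup.T ^ q : Matrix.SpecialLinearGroup (Fin 2) ℤ) :
      Matrix (Fin 2) (Fin 2) ℤ) = !![1, (q : ℤ); 0, 1] := by
    have := ModularGroup.coe_T_zpow q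
    rwa [zpow_natCast] at this
  have redA : red (G 1) = 1 + (q : ZMod n) • !![0, 1; 0, 0] := by
    change ((_ : Matrix (Fin 2) (Fin 2) ℤ)).map _ = _
    simp only [G, one_mul, inv_one, mul_one, hT]
    ext i j; fin_cases i <;> fin_cases j <;> simp
  have redGx : ∀ x : ℕ, red (G (ModularGroup.T ^ x * ModularGroup.S)) =
      1 + (q : ZMod n) • !![-(x : ZMod n), (x : ZMod n) ^ 2; -1, (x : ZMod n)] := by
    intro x
    have hTx : ((ModularGroup.T ^ x : Matrix.SpecialLinearGroup (Fin 2) ℤ) :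
        Matrix (Fin 2) (Fin 2) ℤ) = !![1, (x : ℤ); 0, 1] := by
      have := ModularGroup.coe_T_zpow x
      rwa [zpow_natCast] at this
    change ((_ : Matrix (Fin 2) (Fin 2) ℤ)).map _ = _
    simp only [G, Matrix.SpecialLinearGroup.coe_mul, Matrix.SpecialLinearGroup.coe_inv, hT, hTx,
      ModularGroup.coe_S]
    ext i j; fin_cases i <;> fin_cases j <;> simp [Matrix.adjugate_fin_two] <;> ring
  have redB : red (G ModularGroup.S) = 1 + (q : ZMod n) • !![0, 0; -1, 0] := by
    have := redGx 0
    simpa using this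
  have redC : red (G (ModularGroup.T ^ 1 * ModularGroup.S)) =
      1 + (q : ZMod n) • !![-1, 1; -1, 1] := by
    have := redGx 1
    simpa using this
  set A := G 1 with hA
  set B := G ModularGroup.S with hB
  set C := G (ModularGroup.T ^ 1 * ModularGroup.S) with hC
  have hcomm : ∀ {g h M N}, red g = 1 + (q : ZMod n) • M → red h = 1 + (q : ZMod n) • N →
      Commute (ρ g : V →ₗ[ℂ] V) (ρ h : V →ₗ[ℂ] V) := by
    intro g h M N hg hh
    have : ρ (g * h) = ρ (h * g) := map_eq_of_reduction_eq hker (by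
      change red _ = red _
      rw [map_mul, map_mul, hg, hh, one_add_smul_mul_one_add_smul hqq,
        one_add_smul_mul_one_add_smul hqq, add_comm M N])
    rw [map_mul, map_mul] at this
    exact congrArg Units.val this
  obtain ⟨v, hv, α, β, γ, hα, hβ, hγ⟩ := exists_common_eigenvector (ρ A : V →ₗ[ℂ] V)
    (ρ B : V →ₗ[ℂ] V) (ρ C : V →ₗ[ℂ] V) (hcomm redA redB) (hcomm redA redC) (hcomm redB redC)
  obtain ⟨a, ha, rfl⟩ := eigenvalue_conj_T_pow hspec _ _ hv hα
  obtain ⟨b, hb, rfl⟩ := eigenvalue_conj_T_pow hspec _ _ hv hβ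
  obtain ⟨c, hc, rfl⟩ := eigenvalue_conj_T_pow hspec _ _ hv hγ
  refine ⟨a, b, c, hcop ha, hcop hb, hcop hc, fun x => ?_⟩
  have hrel : ρ (G (ModularGroup.T ^ x * ModularGroup.S) * (B ^ x * A ^ x)) =
      ρ (A ^ (x ^ 2) * B * C ^ x) := map_eq_of_reduction_eq hker (by
    change red _ = red _
    simp only [map_mul, map_pow, redGx, redA, redB, redC, one_add_smul_pow hqq,
      one_add_smul_mul_one_add_smul hqq]
    congr 2
    ext i j; fin_cases i <;> fin_cases j <;> simp)
  have hpow : ∀ {f : Module.End ℂ V} {μ : ℂ} (k : ℕ), f v = μ • v → (f ^ k) v = μ ^ k • v :=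
    fun k h => Module.End.HasEigenvector.pow_apply ⟨Module.End.mem_eigenspace_iff.2 h, hv⟩ k
  set D := G (ModularGroup.T ^ x * ModularGroup.S) with hD
  set ω := ζ ^ q with hωdef
  have hrelv : (ρ D : V →ₗ[ℂ] V) ((ω ^ (a ^ 2)) ^ x • (ω ^ (b ^ 2)) ^ x • v) =
      (ω ^ (c ^ 2)) ^ x • (ω ^ (b ^ 2)) • (ω ^ (a ^ 2)) ^ (x ^ 2) • v := by
    have := congrArg (fun u : (V →ₗ[ℂ] V)ˣ => (u : V →ₗ[ℂ] V) v) hrel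
    simp only [map_mul, map_pow, Units.val_mul, Units.val_pow_eq_pow_val,
      Module.End.mul_apply] at this
    simpa only [hpow x hα, hpow x hβ, hpow x hγ, hpow (x ^ 2) hα, hβ, map_smul] using this
  have hDv : (ρ D : V →ₗ[ℂ] V) v = (ω ^ (x ^ 2 * a ^ 2 + b ^ 2 + x * c ^ 2
      - x * b ^ 2 - x * a ^ 2 : ℤ)) • v := by
    rw [map_smul, map_smul, smul_smul, smul_smul, smul_smul] at hrelv
    have e1 : (ω ^ (a ^ 2)) ^ x * (ω ^ (b ^ 2)) ^ x = ω ^ (x * b ^ 2 + x * a ^ 2 : ℤ) := by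
      rw [← zpow_natCast, ← zpow_natCast, ← zpow_mul, ← zpow_mul, ← zpow_add₀ hω0]
      congr 1; ring
    have e2 : (ω ^ (c ^ 2)) ^ x * ((ω ^ (b ^ 2)) * (ω ^ (a ^ 2)) ^ (x ^ 2)) =
        ω ^ (x * b ^ 2 + x * a ^ 2 : ℤ) *
          ω ^ (x ^ 2 * a ^ 2 + b ^ 2 + x * c ^ 2 - x * b ^ 2 - x * a ^ 2 : ℤ) := by
      rw [← zpow_natCast, ← zpow_natCast, ← zpow_mul, ← zpow_mul, ← zpow_add₀ hω0,
        ← zpow_add₀ hω0, ← zpow_add₀ hω0]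
      congr 1; push_cast; ring
    rw [e1, mul_assoc, e2, mul_smul] at hrelv
    exact smul_right_injective V (zpow_ne_zero _ hω0) hrelv
  obtain ⟨d, hd, h⟩ := eigenvalue_conj_T_pow hspec _ _ hv hDv
  refine ⟨d, hcop hd, ?_⟩
  rw [← hω.zpow_eq_one_iff_dvd]
  rw [← hωdef] at h
  have : d ^ 2 + x * b ^ 2 + x * a ^ 2 - (x ^ 2 * a ^ 2 + b ^ 2 + x * c ^ 2) =
      d ^ 2 - (x ^ 2 * a ^ 2 + b ^ 2 + x * c ^ 2 - x * b ^ 2 - x * a ^ 2 : ℤ) := by ring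
  rw [this, zpow_sub₀ hω0, h, div_self (zpow_ne_zero _ hω0)]

lemma not_sq_dvd_of_odd_prime [Nontrivial V] (hn : 1 ≤ n)
    (hker : CongruenceSubgroup.Gamma n ≤ ρ.ker) (hζ : IsPrimitiveRoot ζ n)
    (hspec : {μ : ℂ | ∃ x : V, x ≠ 0 ∧ (ρ ModularGroup.T : V →ₗ[ℂ] V) x = μ • x}
      = {μ : ℂ | ∃ a : ℤ, IsCoprime a (n : ℤ) ∧ μ = ζ ^ (a ^ 2)})
    {p : ℕ} (hp : p.Prime) (hp2 : p ≠ 2) : ¬ p ^ 2 ∣ n := by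
  rintro ⟨m, hm⟩
  have : Fact p.Prime := ⟨hp⟩
  have hm0 : 0 < m := Nat.pos_of_ne_zero (by rintro rfl; omega)
  obtain ⟨a, b, c, ha, -, -, H⟩ := exists_quadratic_form (q := p * m) (r := p)
    (by rw [hm]; ring) (dvd_mul_right p m) (Nat.mul_pos hp.pos hm0) hp.ne_zero hker hζ hspec
  have hunit : ∀ {a : ℤ}, IsCoprime a (p : ℤ) → (a : ZMod p) ≠ 0 := by
    intro a ha h0
    have h := (ZMod.intCast_zmod_eq_zero_iff_dvd a p).1 h0
    exact (Nat.prime_iff_prime_int.1 hp).not_isUnit (ha.isUnit_of_dvd' h dvd_rfl)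
  refine exists_not_nonzero_square hp2 (hunit ha) (c ^ 2 - a ^ 2 - b ^ 2) (b ^ 2) fun x => ?_
  obtain ⟨d, hd, h⟩ := H x.val
  refine ⟨d, hunit hd, ?_⟩
  have h' := (ZMod.intCast_zmod_eq_zero_iff_dvd _ p).2 h
  push_cast at h'
  rw [ZMod.natCast_zmod_val] at h'
  linear_combination h'

lemma not_sixteen_dvd [Nontrivial V] (hn : 1 ≤ n)
    (hker : CongruenceSubgroup.Gamma n ≤ ρ.ker) (hζ : IsPrimitiveRoot ζ n)
    (hspec : {μ : ℂ | ∃ x : V, x ≠ 0 ∧ (ρ ModularGroup.T : V →ₗ[ℂ] V) x = μ • x}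
      = {μ : ℂ | ∃ a : ℤ, IsCoprime a (n : ℤ) ∧ μ = ζ ^ (a ^ 2)}) : ¬ 16 ∣ n := by
  rintro ⟨m, hm⟩
  obtain ⟨a, b, c, ha, hb, hc, H⟩ := exists_quadratic_form (q := 4 * m) (r := 4)
    (by rw [hm]; ring) (dvd_mul_right 4 m) (by omega) (by norm_num) hker hζ hspec
  have hsq : ∀ {a : ℤ}, IsCoprime a ((4 : ℕ) : ℤ) → a ^ 2 % 4 = 1 := by
    intro a ha
    have h : IsCoprime a 2 := ha.of_isCoprime_of_dvd_right (by norm_num)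
    exact Int.sq_mod_four_eq_one_of_odd (Int.isCoprime_two_right.1 h)
  obtain ⟨d, hd, h⟩ := H 2
  have := hsq ha
  have := hsq hb
  have := hsq hc
  have := hsq hd
  push_cast at h
  omega

lemma not_eight_dvd [Nontrivial V] (hn : 1 ≤ n)
    (hker : CongruenceSubgroup.Gamma n ≤ ρ.ker) (hζ : IsPrimitiveRoot ζ n)
    (hspec : {μ : ℂ | ∃ x : V, x ≠ 0 ∧ (ρ ModularGroup.T : V →ₗ[ℂ] V) x = μ • x}
      = {μ : ℂ | ∃ a : ℤ, IsCoprime a (n : ℤ) ∧ μ = ζ ^ (a ^ 2)}) : ¬ 8 ∣ n := by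
  rintro ⟨m, hm⟩
  have hmodd : m % 2 = 1 := by
    have := not_sixteen_dvd hn hker hζ hspec
    omega
  set ω := ζ ^ m with hωdef
  have hω : IsPrimitiveRoot ω 8 := hζ.pow (by omega) (by rw [hm]; ring)
  have hω0 : ω ≠ 0 := hω.ne_zero (by norm_num)
  have hT : ((ModularGroup.T ^ m : Matrix.SpecialLinearGroup (Fin 2) ℤ) :
      Matrix (Fin 2) (Fin 2) ℤ) = !![1, (m : ℤ); 0, 1] := by
    have := ModularGroup.coe_T_zpow m
    rwa [zpow_natCast] at this
  have heig : ∀ {x : V} {μ : ℂ}, x ≠ 0 →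
      (ρ (ModularGroup.T ^ m) : V →ₗ[ℂ] V) x = μ • x → μ = ω := by
    intro x μ hx h
    obtain ⟨a, ha, rfl⟩ := eigenvalue_conj_T_pow hspec 1 m hx (by simpa using h)
    have h2 : IsCoprime a 2 := ha.of_isCoprime_of_dvd_right (by
      rw [hm]; push_cast; exact ⟨4 * m, by ring⟩)
    have h8 : a ^ 2 % 8 = 1 := by
      obtain ⟨k, rfl⟩ := Int.isCoprime_two_right.1 h2
      obtain ⟨j, hj⟩ := Int.even_mul_succ_self k
      have : (2 * k + 1) ^ 2 = 8 * j + 1 := by linear_combination 4 * hj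
      omega
    rw [← hωdef, ← div_eq_one_iff_eq hω0, div_eq_mul_inv, ← zpow_sub_one₀ hω0, hω.zpow_eq_one_iff_dvd]
    push_cast
    omega
  have hscalar : (ρ (ModularGroup.T ^ m) : Module.End ℂ V) = algebraMap ℂ _ ω := by
    set t : Module.End ℂ V := (ρ (ModularGroup.T ^ m) : V →ₗ[ℂ] V) with ht
    have ht8 : t ^ 8 = 1 := by
      have h : ρ ((ModularGroup.T ^ m) ^ 8) = ρ 1 := map_eq_of_reduction_eq hker (by
        have h8m : (m : ZMod n) * 8 = 0 := by
          have : ((m * 8 : ℕ) : ZMod n) = 0 := (ZMod.natCast_eq_zero_iff _ _).2 (by rw [hm, mul_comm])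
          exact_mod_cast this
        have hcoe := ModularGroup.coe_T_zpow ((m * 8 : ℕ) : ℤ)
        rw [zpow_natCast] at hcoe
        rw [← pow_mul, hcoe]
        ext i j; fin_cases i <;> fin_cases j <;> simp [h8m])
      rw [map_pow, map_one] at h
      exact congrArg Units.val h
    have hss : t.IsSemisimple := by
      refine Module.End.isSemisimple_of_squarefree_aeval_eq_zero (p := Polynomial.X ^ 8 -
        Polynomial.C 1) (Polynomial.separable_X_pow_sub_C (1 : ℂ) (by norm_num)
          one_ne_zero).squarefree ?_
      simp [ht8]
    have htop : Module.End.eigenspace t ω = ⊤ := by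
      rw [eq_top_iff, ← hss.iSup_eigenspace_eq_top]
      refine iSup_le fun μ x hx => ?_
      rcases eq_or_ne x 0 with rfl | hx0
      · exact zero_mem _
      · exact heig hx0 (Module.End.mem_eigenspace_iff.1 hx) ▸ hx
    ext x
    exact Module.End.mem_eigenspace_iff.1 (htop ▸ Submodule.mem_top : x ∈ _)
  set S : Matrix.SpecialLinearGroup (Fin 2) ℤ := ModularGroup.S
  set t : Matrix.SpecialLinearGroup (Fin 2) ℤ := ModularGroup.T ^ m with ht
  have hrel : ρ ((t * (S * t * S⁻¹) * t) ^ 4) = ρ 1 := map_eq_of_reduction_eq hker (by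
    have hcube : (m : ZMod n) ^ 3 = m := by
      have hd : (n : ℤ) ∣ (m : ℤ) ^ 3 - m := by
        obtain ⟨k, hk⟩ : ∃ k, m = 2 * k + 1 := ⟨m / 2, by omega⟩
        obtain ⟨j, hj⟩ := Nat.even_mul_succ_self k
        zify at hk hj
        refine ⟨j, ?_⟩
        rw [hm]
        push_cast
        linear_combination (m : ℤ) * (m + 2 * k + 1) * hk + 4 * m * hj
      have := (ZMod.intCast_zmod_eq_zero_iff_dvd _ n).2 hd
      push_cast at this
      exact sub_eq_zero.1 this
    have hw : ((t * (S * t * S⁻¹) * t : Matrix.SpecialLinearGroup (Fin 2) ℤ) :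
        Matrix (Fin 2) (Fin 2) ℤ).map (Int.castRingHom (ZMod n)) =
        !![1 - (m : ZMod n) ^ 2, (m : ZMod n); -(m : ZMod n), 1 - (m : ZMod n) ^ 2] := by
      simp only [Matrix.SpecialLinearGroup.coe_mul, Matrix.SpecialLinearGroup.coe_inv, hT, S,
        ModularGroup.coe_S]
      ext i j
      fin_cases i <;> fin_cases j <;> simp [Matrix.adjugate_fin_two]
      · ring
      · linear_combination (-1 : ZMod n) * hcube
      · ring
    rw [Matrix.SpecialLinearGroup.coe_pow, Matrix.map_pow, hw]
    have hw2 : !![1 - (m : ZMod n) ^ 2, (m : ZMod n); -(m : ZMod n), 1 - (m : ZMod n) ^ 2] ^ 2 =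
        !![1 - 2 * (m : ZMod n) ^ 2, 0; 0, 1 - 2 * (m : ZMod n) ^ 2] := by
      rw [pow_two, Matrix.mul_fin_two]
      ext i j
      fin_cases i <;> fin_cases j <;> simp
      · linear_combination (m : ZMod n) * hcube
      · linear_combination (-2 : ZMod n) * hcube
      · linear_combination (2 : ZMod n) * hcube
      · linear_combination (m : ZMod n) * hcube
    rw [show 4 = 2 * 2 from rfl, pow_mul, hw2, pow_two, Matrix.mul_fin_two]
    ext i j
    fin_cases i <;> fin_cases j <;> simp <;> linear_combination 4 * (m : ZMod n) * hcube)
  have h12 : algebraMap ℂ (Module.End ℂ V) (ω ^ 12) = algebraMap ℂ (Module.End ℂ V) 1 := by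
    have hc : ρ (S * t * S⁻¹) = ρ t := by
      rw [map_mul, map_mul, map_inv, mul_inv_eq_iff_eq_mul]
      refine Units.ext ?_
      rw [Units.val_mul, Units.val_mul, hscalar]
      exact (Algebra.commutes _ _).symm
    rw [map_pow, map_mul, map_mul, hc, map_one] at hrel
    have h := congrArg Units.val hrel
    rw [Units.val_pow_eq_pow_val, Units.val_mul, Units.val_mul, hscalar, Units.val_one] at h
    rw [map_one, map_pow, ← h]
    noncomm_ring
  have h := FaithfulSMul.algebraMap_injective ℂ (Module.End ℂ V) h12
  have := (hω.pow_eq_one_iff_dvd 12).1 h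
  omega

end Level

/-- If `ρ : SL(2,ℤ) → GL(V)` is an irreducible representation of level `n`
(its kernel contains `Γ(n)` and `ρ(T)` has order exactly `n`) which is minimal, i.e.
`dim V = φ₂(n)` and the eigenvalues of `ρ(T)` are exactly `{ζ^(a²) : gcd(a,n)=1}` for some
primitive `n`-th root of unity `ζ`, then `n = d·p₁⋯pℓ` with `d ∣ 12` and distinct primes
`pᵢ > 3`; equivalently `8 ∤ n`, `9 ∤ n`, and `p² ∤ n` for every prime `p > 3`. -/
theorem level_of_minimal_irreducible
    (n : ℕ) (hn : 1 ≤ n) (V : Type*) [AddCommGroup V] [Module ℂ V] [FiniteDimensional ℂ V]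
    (ρ : Matrix.SpecialLinearGroup (Fin 2) ℤ →* (V →ₗ[ℂ] V)ˣ)
    (hker : CongruenceSubgroup.Gamma n ≤ ρ.ker)
    (hirr : ∀ U : Submodule ℂ V,
      (∀ g : Matrix.SpecialLinearGroup (Fin 2) ℤ, ∀ x ∈ U, (ρ g : V →ₗ[ℂ] V) x ∈ U) →
      U = ⊥ ∨ U = ⊤)
    (horder : orderOf (ρ ModularGroup.T) = n)
    (hdim : Module.finrank ℂ V = phi2 n)
    (ζ : ℂ) (hζ : IsPrimitiveRoot ζ n)
    (hspec : {μ : ℂ | ∃ x : V, x ≠ 0 ∧ (ρ ModularGroup.T : V →ₗ[ℂ] V) x = μ • x}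
      = {μ : ℂ | ∃ a : ℤ, IsCoprime a (n : ℤ) ∧ μ = ζ ^ (a ^ 2)}) :
    ¬ (8 ∣ n) ∧ ¬ (9 ∣ n) ∧ ∀ p : ℕ, p.Prime → 3 < p → ¬ (p ^ 2 ∣ n) := by
  have hV : Nontrivial V := by
    have h1 : ζ ∈ {μ : ℂ | ∃ a : ℤ, IsCoprime a (n : ℤ) ∧ μ = ζ ^ (a ^ 2)} :=
      ⟨1, isCoprime_one_left, by simp⟩
    rw [← hspec] at h1
    obtain ⟨x, hx, -⟩ := h1
    exact ⟨x, 0, hx⟩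
  refine ⟨not_eight_dvd hn hker hζ hspec,
    not_sq_dvd_of_odd_prime hn hker hζ hspec Nat.prime_three (by norm_num), fun p hp hp3 =>
    not_sq_dvd_of_odd_prime hn hker hζ hspec hp (by omega)⟩
end

section
/- Let n ≥ 1, let ζ be a primitive n-th root of unity in ℂ, and let ρ₁ : SL(2,ℤ) → GL(V₁) and ρ₂ : SL(2,ℤ) → GL(V₂) be two irreducible representations on finite-dimensional complex vector spaces, each with kernel containing the principal congruence subgroup Γ(n), each with image of T of multiplicative order exactly n, each of dimension φ₂(n) (the number of squares in (ℤ/nℤ)ˣ), and each with set of eigenvalues of the image of T equal to {ζ^{a²} : a an integer coprime to n}. Then ρ₁ and ρ₂ are equivalent: there exists a linear isomorphism V₁ → V₂ intertwining the two actions of SL(2,ℤ). -/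
open scoped MatrixGroups

namespace SLTwo

section Matrices

variable {R : Type*} [CommRing R]

/-- The unipotent matrix `[[1, x], [0, 1]]`. -/
def tMat (x : R) : SL(2, R) := ⟨!![1, x; 0, 1], by simp [Matrix.det_fin_two]⟩

/-- The diagonal matrix `[[a, 0], [0, a⁻¹]]`. -/
def dMat (a : Rˣ) : SL(2, R) :=
  ⟨!![(a : R), 0; 0, ((a⁻¹ : Rˣ) : R)], by simp [Matrix.det_fin_two]⟩

/-- The matrix `[[0, -1], [1, 0]]`. -/
def sMat (R : Type*) [CommRing R] : SL(2, R) := ⟨!![0, -1; 1, 0], by simp [Matrix.det_fin_two]⟩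

theorem ext_entries {g h : SL(2, R)} (h00 : g.1 0 0 = h.1 0 0) (h01 : g.1 0 1 = h.1 0 1)
    (h10 : g.1 1 0 = h.1 1 0) (h11 : g.1 1 1 = h.1 1 1) : g = h := by
  apply Subtype.ext
  ext i j
  fin_cases i <;> fin_cases j <;> assumption

theorem mul_entry (g h : SL(2, R)) (i j : Fin 2) :
    (g * h).1 i j = g.1 i 0 * h.1 0 j + g.1 i 1 * h.1 1 j := by
  rw [Matrix.SpecialLinearGroup.coe_mul, Matrix.mul_apply, Fin.sum_univ_two]

theorem tMat_val (x : R) : (tMat x).1 = !![1, x; 0, 1] := rfl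

theorem dMat_val (a : Rˣ) : (dMat a).1 = !![(a : R), 0; 0, ((a⁻¹ : Rˣ) : R)] := rfl

theorem sMat_val : (sMat R).1 = !![0, -1; 1, 0] := rfl

theorem tMat_zero : tMat (0 : R) = 1 := by
  apply ext_entries <;> simp [tMat]

theorem tMat_add (x y : R) : tMat (x + y) = tMat x * tMat y := by
  apply ext_entries <;> simp [mul_entry, tMat_val, add_comm]

theorem dMat_one : dMat (1 : Rˣ) = 1 := by
  apply ext_entries <;> simp [dMat]

theorem dMat_mul (a b : Rˣ) : dMat (a * b) = dMat a * dMat b := by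
  apply ext_entries <;> simp [mul_entry, dMat_val, mul_comm]

theorem tMat_mul_dMat (x : R) (a : Rˣ) :
    tMat x * dMat a = dMat a * tMat (x * ((a⁻¹ ^ 2 : Rˣ) : R)) := by
  apply ext_entries <;> simp [mul_entry, dMat_val, tMat_val]
  linear_combination (- x * ((a⁻¹ : Rˣ) : R)) * a.mul_inv

theorem sMat_mul_dMat (a : Rˣ) : sMat R * dMat a = dMat a⁻¹ * sMat R := by
  apply ext_entries <;> simp [mul_entry, dMat_val, sMat_val]

theorem sMat_tMat_pow_three : (sMat R * tMat 1) ^ 3 = sMat R ^ 2 := by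
  simp only [pow_succ, pow_zero, one_mul]
  apply ext_entries <;> simp [mul_entry, tMat_val, sMat_val]

/-- A member of `SL(2, R)` with a unit in the lower right corner is a product of a unipotent,
a diagonal and a transposed unipotent matrix. -/
theorem eq_mul_of_unit_corner (g : SL(2, R)) (d : Rˣ) (hd : g.1 1 1 = d) :
    g = tMat (g.1 0 1 * (d⁻¹ : Rˣ)) * dMat d⁻¹ * (sMat R * tMat (-(g.1 1 0 * (d⁻¹ : Rˣ))) *
      (sMat R)⁻¹) := by
  have hdet := g.2
  rw [Matrix.det_fin_two, hd] at hdet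
  have hd' := d.mul_inv
  apply ext_entries <;> simp [mul_entry, tMat_val, sMat_val, dMat_val, hd]
  · linear_combination (- g.1 0 0 + g.1 0 1 * g.1 1 0 * ((d⁻¹ : Rˣ) : R)) * hd' +
      ((d⁻¹ : Rˣ) : R) * hdet - g.1 0 1 * g.1 1 0 * ((d⁻¹ : Rˣ) : R) * hd'
  · linear_combination (- g.1 1 0) * hd'

theorem dMat_eq_mul (a : Rˣ) :
    dMat a = tMat (a : R) * (sMat R * tMat ((a⁻¹ : Rˣ) : R) * (sMat R)⁻¹) * tMat (a : R) *
      sMat R := by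
  apply ext_entries <;> simp [mul_entry, tMat_val, sMat_val, dMat_val]

end Matrices

/-- Reduction modulo `n`. -/
abbrev slMod (n : ℕ) : SL(2, ℤ) →* SL(2, ZMod n) :=
  Matrix.SpecialLinearGroup.map (Int.castRingHom (ZMod n))

theorem slMod_entry (n : ℕ) (g : SL(2, ℤ)) (i j : Fin 2) :
    (slMod n g).1 i j = (g.1 i j : ZMod n) := rfl

theorem map_T (n : ℕ) : slMod n ModularGroup.T = tMat 1 := by
  apply ext_entries <;> rw [slMod_entry] <;> simp [tMat_val, ModularGroup.T]

theorem map_S (n : ℕ) : slMod n ModularGroup.S = sMat (ZMod n) := by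
  apply ext_entries <;> rw [slMod_entry] <;> simp [sMat_val, ModularGroup.S]

/-- Given `gcd(c, d, n) = 1`, some `d + c * k` is coprime to `n`. -/
theorem exists_isUnit_add_mul {n : ℕ} [NeZero n] {a b c d : ZMod n} (h : a * d - b * c = 1) :
    ∃ k : ZMod n, IsUnit (d + c * k) := by
  classical
  refine ⟨((∏ p ∈ n.primeFactors with ¬ p ∣ d.val, p : ℕ) : ZMod n), ?_⟩
  set K := ∏ p ∈ n.primeFactors with ¬ p ∣ d.val, p with hK
  have e : d + c * (K : ZMod n) = ((d.val + c.val * K : ℕ) : ZMod n) := by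
    push_cast; simp
  rw [e, ZMod.isUnit_iff_coprime]
  refine Nat.Coprime.symm (Nat.coprime_of_dvd fun p hp hpn hpd => ?_)
  have hmem : p ∈ n.primeFactors := Nat.mem_primeFactors.2 ⟨hp, hpn, NeZero.ne n⟩
  by_cases hd : p ∣ d.val
  · have h1 : p ∣ c.val * K := (Nat.dvd_add_right hd).1 hpd
    rcases hp.dvd_mul.1 h1 with h2 | h2
    · have hc := congrArg (ZMod.castHom hpn (ZMod p)) h
      have zc : ∀ x : ZMod n, p ∣ x.val → ZMod.castHom hpn (ZMod p) x = 0 := fun x hx => by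
        rw [← ZMod.natCast_zmod_val x, map_natCast]
        exact (ZMod.natCast_eq_zero_iff _ _).2 hx
      have := Fact.mk hp
      rw [map_sub, map_mul, map_mul, zc d hd, zc c h2, map_one] at hc
      simp at hc
    · rw [hK, Prime.dvd_finsetProd_iff hp.prime] at h2
      obtain ⟨q, hq, hpq⟩ := h2
      simp only [Finset.mem_filter, Nat.mem_primeFactors] at hq
      rw [(Nat.prime_dvd_prime_iff_eq hp hq.1.1).1 hpq] at hd
      exact hq.2 hd
  · have h2 : p ∣ K := Finset.dvd_prod_of_mem _ (by simp [hmem, hd] : p ∈ _)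
    exact hd ((Nat.dvd_add_left (h2.mul_left _)).1 hpd)

theorem map_surjective (n : ℕ) [NeZero n] : Function.Surjective (slMod n) := by
  have ht : ∀ x : ZMod n, tMat x ∈ (slMod n).range := fun x => by
    refine ⟨tMat (x.val : ℤ), ?_⟩
    apply ext_entries <;> simp [tMat_val]
  have hs : sMat (ZMod n) ∈ (slMod n).range := ⟨_, map_S n⟩
  have hd : ∀ a : (ZMod n)ˣ, dMat a ∈ (slMod n).range := fun a => by
    rw [dMat_eq_mul]
    exact mul_mem (mul_mem (mul_mem (ht _) (mul_mem (mul_mem hs (ht _)) (inv_mem hs))) (ht _)) hs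
  intro g
  have hg := g.2
  rw [Matrix.det_fin_two] at hg
  obtain ⟨k, d, hk⟩ := exists_isUnit_add_mul hg
  have h1 : g * tMat k ∈ (slMod n).range := by
    rw [eq_mul_of_unit_corner (g * tMat k) d
      (by simp [mul_entry, tMat_val, hk, add_comm])]
    exact mul_mem (mul_mem (ht _) (hd _)) (mul_mem (mul_mem hs (ht _)) (inv_mem hs))
  exact (Subgroup.mul_mem_cancel_right _ (ht k)).1 h1

/-- A representation of `SL(2, R)` together with a vector `v` spanning the `ψ`-eigenspace of the
unipotent subgroup, an equivariant functional `P` with `P v = 1`, such that the orbit of `v`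
under the diagonal torus spans the whole space. -/
structure TorusCyclic {R : Type*} [CommRing R] (ψ : AddChar R ℂ) {V : Type*} [AddCommGroup V]
    [Module ℂ V] (ρ : SL(2, R) →* Module.End ℂ V) where
  v : V
  P : V →ₗ[ℂ] ℂ
  T_v : ∀ x, ρ (tMat x) v = ψ x • v
  P_T : ∀ x w, P (ρ (tMat x) w) = ψ x * P w
  P_v : P v = 1
  eig : ∀ w, (∀ x, ρ (tMat x) w = ψ x • w) → w = P w • v
  span_eq : Submodule.span ℂ (Set.range fun a : Rˣ => ρ (dMat a) v) = ⊤

namespace TorusCyclic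

variable {R : Type*} [CommRing R] {ψ : AddChar R ℂ} {V : Type*} [AddCommGroup V]
    [Module ℂ V] {ρ : SL(2, R) →* Module.End ℂ V} (D : TorusCyclic ψ ρ)

include D in
theorem v_ne_zero : D.v ≠ 0 := fun h => by simpa [h] using D.P_v

theorem map_mul_apply (g h : SL(2, R)) (w : V) : ρ (g * h) w = ρ g (ρ h w) := by
  rw [map_mul, Module.End.mul_apply]

theorem T_d (x : R) (a : Rˣ) :
    ρ (tMat x) (ρ (dMat a) D.v) = ψ (x * ((a⁻¹ ^ 2 : Rˣ) : R)) • ρ (dMat a) D.v := by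
  rw [← map_mul_apply, tMat_mul_dMat, map_mul_apply, D.T_v, map_smul]

theorem P_d_T (x : R) (b : Rˣ) (w : V) :
    D.P (ρ (dMat b) (ρ (tMat x) w)) = ψ (x * ((b ^ 2 : Rˣ) : R)) * D.P (ρ (dMat b) w) := by
  rw [← D.P_T, ← map_mul_apply, ← map_mul_apply, tMat_mul_dMat, mul_assoc, ← Units.val_mul,
    ← mul_pow, mul_inv_cancel, one_pow, Units.val_one, mul_one]

theorem P_d_eq_zero (hψ : Function.Injective ψ) (a : Rˣ) (ha : a ^ 2 ≠ 1) :
    D.P (ρ (dMat a) D.v) = 0 := by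
  have h := D.P_T 1 (ρ (dMat a) D.v)
  rw [D.T_d, map_smul, smul_eq_mul, one_mul] at h
  by_contra h0
  have h1 := hψ (mul_right_cancel₀ h0 h)
  rw [Units.val_eq_one, inv_pow, inv_eq_one] at h1
  exact ha h1

theorem d_v_of_sq_eq_one (a : Rˣ) (ha : a ^ 2 = 1) :
    ρ (dMat a) D.v = D.P (ρ (dMat a) D.v) • D.v := by
  refine D.eig _ fun x => ?_
  rw [D.T_d, inv_pow, ha, inv_one, Units.val_one, mul_one]

/-- The scalar by which `diag(a, a⁻¹)` acts when `a² = 1`. -/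
def chi (a : Rˣ) : ℂ := D.P (ρ (dMat a) D.v)

theorem chi_mul (a b : Rˣ) (hb : b ^ 2 = 1) : D.chi (a * b) = D.chi a * D.chi b := by
  rw [chi, dMat_mul, map_mul_apply, D.d_v_of_sq_eq_one b hb, map_smul, map_smul, smul_eq_mul,
    mul_comm]
  rfl

theorem chi_one : D.chi 1 = 1 := by
  rw [chi, dMat_one, map_one, Module.End.one_apply, D.P_v]

theorem hom_ext {W : Type*} [AddCommGroup W] [Module ℂ W] {f g : V →ₗ[ℂ] W}
    (h : ∀ a : Rˣ, f (ρ (dMat a) D.v) = g (ρ (dMat a) D.v)) : f = g :=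
  LinearMap.ext_on_range D.span_eq h

/-- The matrix coefficient of `S` on the torus orbit of `v`. -/
def coeff (x : Rˣ) : ℂ := D.P (ρ (sMat R) (ρ (dMat x) D.v))

theorem coeff_mul (x u : Rˣ) (hu : u ^ 2 = 1) : D.coeff (x * u) = D.chi u * D.coeff x := by
  rw [coeff, dMat_mul, map_mul_apply, D.d_v_of_sq_eq_one u hu, map_smul, map_smul, map_smul,
    smul_eq_mul]
  rfl

/-- The element `[[τ, -x⁻¹], [x, 0]]`. -/
def companion (τ : R) (x : Rˣ) : SL(2, R) := tMat (τ * (x⁻¹ : Rˣ)) * sMat R * dMat x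

theorem companion_val (τ : R) (x : Rˣ) :
    (companion τ x).1 = !![τ, -((x⁻¹ : Rˣ) : R); (x : R), 0] := by
  ext i j
  fin_cases i <;> fin_cases j <;> simp [companion, mul_entry, tMat_val, sMat_val, dMat_val]

theorem d_companion_d (τ : R) (x b : Rˣ) :
    dMat b⁻¹ * companion τ x * dMat b = companion τ (x * b ^ 2) := by
  apply ext_entries <;> simp [mul_entry, companion_val, dMat_val, pow_two]
  · rw [mul_right_comm, Units.inv_mul, one_mul]
  · ring
  · ring

variable [Fintype R] [DecidableEq R]

/-- The number of square roots of one. -/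
def rootCount (R : Type*) [CommRing R] [Fintype R] [DecidableEq R] : ℂ :=
  (Finset.univ.filter fun a : Rˣ => a ^ 2 = 1).card

theorem rootCount_ne_zero : rootCount R ≠ 0 := by
  rw [rootCount, Nat.cast_ne_zero]
  exact Finset.card_ne_zero_of_mem (a := 1) (by simp)

theorem sum_smul_eq {W : Type*} [AddCommGroup W] [Module ℂ W] (c : Rˣ → ℂ) (f : Rˣ → W) (w : W)
    (h : ∀ u : Rˣ, u ^ 2 = 1 → c u • f u = w) (h0 : ∀ u : Rˣ, u ^ 2 ≠ 1 → c u = 0) :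
    ∑ u, c u • f u = rootCount R • w := by
  rw [rootCount, ← Finset.sum_filter_add_sum_filter_not _ (fun a : Rˣ => a ^ 2 = 1),
    Finset.sum_congr rfl (fun u hu => h u (Finset.mem_filter.1 hu).2), Finset.sum_const,
    Finset.sum_eq_zero fun u hu => by rw [h0 u (Finset.mem_filter.1 hu).2, zero_smul], add_zero,
    Nat.cast_smul_eq_nsmul]

theorem sum_transfer (hψ : Function.Injective ψ) {V' : Type*} [AddCommGroup V'] [Module ℂ V']
    {ρ' : SL(2, R) →* Module.End ℂ V'} (D' : TorusCyclic ψ ρ')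
    (hchi : ∀ u : Rˣ, u ^ 2 = 1 → D.chi u = D'.chi u) (a : Rˣ) :
    ∑ b : Rˣ, D.P (ρ (dMat b⁻¹) (ρ (dMat a) D.v)) • ρ' (dMat b) D'.v =
      rootCount R • ρ' (dMat a) D'.v := by
  rw [← Equiv.sum_comp (Equiv.mulLeft a)]
  have h1 : ∀ u : Rˣ, D.P (ρ (dMat (a * u)⁻¹) (ρ (dMat a) D.v)) = D.chi u⁻¹ := fun u => by
    rw [← map_mul_apply, ← dMat_mul, mul_inv_rev, inv_mul_cancel_right, chi]
  simp only [Equiv.coe_mulLeft, h1]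
  refine sum_smul_eq _ _ _ (fun u hu => ?_) fun u hu => ?_
  · have hu' : u⁻¹ ^ 2 = 1 := by rw [inv_pow, hu, inv_one]
    rw [dMat_mul, map_mul_apply, D'.d_v_of_sq_eq_one u hu, map_smul, smul_smul, hchi _ hu']
    change (D'.chi u⁻¹ * D'.chi u) • _ = _
    rw [← D'.chi_mul _ _ hu, inv_mul_cancel, D'.chi_one, one_smul]
  · exact D.P_d_eq_zero hψ _ (by rwa [inv_pow, ne_eq, inv_eq_one])

theorem sum_resolution (hψ : Function.Injective ψ) :
    ∑ b : Rˣ, (D.P ∘ₗ ρ (dMat b⁻¹)).smulRight (ρ (dMat b) D.v) =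
      rootCount R • (LinearMap.id : V →ₗ[ℂ] V) := by
  refine D.hom_ext fun a => ?_
  rw [LinearMap.sum_apply, LinearMap.smul_apply, LinearMap.id_apply]
  exact D.sum_transfer hψ D (fun _ _ => rfl) a

theorem resolution (hψ : Function.Injective ψ) (w : V) :
    ∑ b : Rˣ, D.P (ρ (dMat b⁻¹) w) • ρ (dMat b) D.v = rootCount R • w := by
  have := LinearMap.congr_fun (D.sum_resolution hψ) w
  simpa [LinearMap.sum_apply] using this

theorem trace_eq [FiniteDimensional ℂ V] (hψ : Function.Injective ψ) (g : SL(2, R)) :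
    rootCount R * LinearMap.trace ℂ V (ρ g) =
      ∑ b : Rˣ, D.P (ρ (dMat b⁻¹ * g * dMat b) D.v) := by
  have h : rootCount R • ρ g =
      ∑ b : Rˣ, (D.P ∘ₗ ρ (dMat b⁻¹)).smulRight (ρ g (ρ (dMat b) D.v)) := by
    ext w
    rw [LinearMap.smul_apply, ← map_smul, ← D.resolution hψ, map_sum, LinearMap.sum_apply]
    simp
  rw [← smul_eq_mul, ← map_smul, h, map_sum]
  refine Finset.sum_congr rfl fun b _ => ?_
  rw [LinearMap.trace_smulRight, LinearMap.comp_apply, map_mul_apply, map_mul_apply]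

theorem S_d_v (hψ : Function.Injective ψ) :
    rootCount R • ρ (sMat R) D.v = ∑ b : Rˣ, D.coeff b • ρ (dMat b) D.v := by
  rw [← D.resolution hψ]
  refine Finset.sum_congr rfl fun b _ => ?_
  rw [coeff, ← map_mul_apply, ← map_mul_apply, sMat_mul_dMat]

theorem trace_companion [FiniteDimensional ℂ V] (hψ : Function.Injective ψ) (τ : R) (x : Rˣ) :
    rootCount R * LinearMap.trace ℂ V (ρ (companion τ x)) =
      ∑ b : Rˣ, ψ (τ * ((x * b ^ 2)⁻¹ : Rˣ)) * D.coeff (x * b ^ 2) := by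
  rw [D.trace_eq hψ]
  refine Finset.sum_congr rfl fun b _ => ?_
  rw [d_companion_d, companion, map_mul_apply, map_mul_apply, D.P_T, coeff]

end TorusCyclic

section Arithmetic

/-- In a field of odd prime order, no nonzero translate of the set of squares is contained in it. -/
theorem exists_sq_add_not_isSquare {p : ℕ} [Fact p.Prime] (hp : p ≠ 2) {δ : ZMod p}
    (hδ : δ ≠ 0) : ∃ w : ZMod p, ¬ IsSquare (w ^ 2 + δ) := by
  by_contra! h
  have hk : ∀ k : ℕ, IsSquare ((k : ZMod p) * δ) := fun k => by
    induction k with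
    | zero => simp
    | succ k ih =>
      obtain ⟨w, hw⟩ := ih
      rw [Nat.cast_succ, add_mul, one_mul, hw, ← pow_two]
      exact h w
  obtain ⟨y, hy⟩ := FiniteField.exists_nonsquare (F := ZMod p) (by rwa [ZMod.ringChar_zmod_n])
  refine hy ?_
  have := hk (y * δ⁻¹).val
  rwa [ZMod.natCast_zmod_val, inv_mul_cancel_right₀ hδ] at this

theorem two_ne_zero_zmod {p : ℕ} [Fact p.Prime] (hp : p ≠ 2) : (2 : ZMod p) ≠ 0 :=
  Ring.two_ne_zero (by rwa [ZMod.ringChar_zmod_n])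

theorem exists_quadratic_not_isSquare {p : ℕ} [Fact p.Prime] (hp : p ≠ 2) {a b c : ZMod p}
    (ha : a ≠ 0) (h : 4 * a ^ 2 * c ≠ b ^ 2) :
    ∃ w : ZMod p, ¬ IsSquare (a ^ 2 * w ^ 2 + b * w + c) := by
  obtain ⟨w, hw⟩ := exists_sq_add_not_isSquare hp (sub_ne_zero.2 h)
  have h2 := two_ne_zero_zmod hp
  refine ⟨(w - b) / (2 * a ^ 2), fun ⟨y, hy⟩ => hw ⟨2 * a * y, ?_⟩⟩
  have : 2 * a * y * (2 * a * y) = 4 * a ^ 2 * (y * y) := by ring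
  rw [this, ← hy]
  field_simp
  ring

variable {m : ℕ}

theorem intCast_eq_zero_of_primes (hm : Squarefree m) (k : ℤ)
    (h : ∀ p ∈ m.primeFactors, (p : ℤ) ∣ k) : (k : ZMod m) = 0 := by
  rw [ZMod.intCast_zmod_eq_zero_iff_dvd, ← Nat.prod_primeFactors_of_squarefree hm,
    Int.natCast_dvd]
  exact Finset.prod_primes_dvd _ (fun p hp => (Nat.prime_of_mem_primeFactors hp).prime)
    fun p hp => Int.natCast_dvd.1 (h p hp)

theorem coprime_div_of_squarefree (hm : Squarefree m) {p : ℕ} (hp : p ∈ m.primeFactors) :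
    Nat.Coprime p (m / p) := by
  have h := Nat.mul_div_cancel' (Nat.dvd_of_mem_primeFactors hp)
  rw [← h] at hm
  exact Nat.coprime_of_squarefree_mul hm

/-- A family of integers reducing to the primitive idempotents of `ℤ/mℤ`. -/
theorem exists_idempotents (hm : Squarefree m) :
    ∃ E : ℕ → ℤ, ∀ p ∈ m.primeFactors, (p : ℤ) ∣ E p - 1 ∧ ((m / p : ℕ) : ℤ) ∣ E p := by
  have h : ∀ p, ∃ E : ℤ, p ∈ m.primeFactors → (p : ℤ) ∣ E - 1 ∧ ((m / p : ℕ) : ℤ) ∣ E := by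
    intro p
    by_cases hp : p ∈ m.primeFactors
    · obtain ⟨a, b, hab⟩ := Nat.isCoprime_iff_coprime.2 (coprime_div_of_squarefree hm hp)
      exact ⟨b * (m / p : ℕ), fun _ =>
        ⟨⟨-a, by linear_combination hab⟩, Dvd.intro_left _ rfl⟩⟩
    · exact ⟨0, fun h => absurd h hp⟩
  choose E hE using h
  exact ⟨E, hE⟩

theorem idempotent_mul_eq_zero_iff {p : ℕ} (hp : p ∈ m.primeFactors) {E : ℤ}
    (h1 : (p : ℤ) ∣ E - 1) (h2 : ((m / p : ℕ) : ℤ) ∣ E) (k : ℤ) :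
    (E : ZMod m) * k = 0 ↔ (p : ℤ) ∣ k := by
  have hpm := Nat.dvd_of_mem_primeFactors hp
  rw [← Int.cast_mul, ZMod.intCast_zmod_eq_zero_iff_dvd]
  constructor
  · intro h
    have h3 : (p : ℤ) ∣ E * k := (Int.natCast_dvd_natCast.2 hpm).trans h
    have : k = E * k - (E - 1) * k := by ring
    rw [this]
    exact dvd_sub h3 (h1.mul_right _)
  · intro h
    rw [← Nat.mul_div_cancel' hpm, Nat.cast_mul, mul_comm E]
    exact mul_dvd_mul h h2

theorem idempotent_mul_self {p : ℕ} (hp : p ∈ m.primeFactors) {E : ℤ}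
    (h1 : (p : ℤ) ∣ E - 1) (h2 : ((m / p : ℕ) : ℤ) ∣ E) :
    (E : ZMod m) * E = E := by
  have := (idempotent_mul_eq_zero_iff hp h1 h2 _).2 h1
  push_cast at this
  linear_combination this

theorem jacobiSym_val [NeZero m] (k : ℤ) : jacobiSym ((k : ZMod m).val : ℤ) m = jacobiSym k m := by
  rw [ZMod.val_intCast, ← jacobiSym.mod_left]

/-- The Jacobi symbol as a character of `(ℤ/mℤ)ˣ`. -/
noncomputable def jacobiChar (m : ℕ) [NeZero m] : (ZMod m)ˣ →* ℂ where
  toFun x := (jacobiSym ((x : ZMod m).val : ℤ) m : ℂ)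
  map_one' := by
    have := jacobiSym_val (m := m) 1
    rw [Int.cast_one] at this
    rw [Units.val_one, this, jacobiSym.one_left, Int.cast_one]
  map_mul' x y := by
    rw [← Int.cast_mul, ← jacobiSym.mul_left, ← jacobiSym_val (_ * _)]
    simp

theorem jacobiChar_sq [NeZero m] (x : (ZMod m)ˣ) : jacobiChar m (x ^ 2) = 1 := by
  have h : IsCoprime ((x : ZMod m).val : ℤ) m :=
    Nat.isCoprime_iff_coprime.2 (ZMod.val_coe_unit_coprime x)
  rw [map_pow]
  change ((jacobiSym _ m : ℤ) : ℂ) ^ 2 = 1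
  exact_mod_cast jacobiSym.sq_one (Int.isCoprime_iff_gcd_eq_one.1 h)

theorem exists_jacobiChar_eq_neg_one [NeZero m] (hodd : Odd m) (hm : Squarefree m) (τ : ZMod m)
    (hτ : τ ^ 2 ≠ 4) :
    ∃ (r : (ZMod m)ˣ) (u v : ZMod m), jacobiChar m r = -1 ∧ u ^ 2 + τ * u * v + v ^ 2 = r := by
  obtain ⟨t, rfl⟩ := ZMod.intCast_surjective τ
  have hp : ∃ p ∈ m.primeFactors, ¬ (p : ℤ) ∣ t ^ 2 - 4 := by
    by_contra! h
    have := intCast_eq_zero_of_primes hm _ h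
    push_cast at this
    exact hτ (sub_eq_zero.1 this)
  obtain ⟨p, hp, hpt⟩ := hp
  obtain ⟨E, hE⟩ := exists_idempotents hm
  obtain ⟨h1, h2⟩ := hE p hp
  have hpm := Nat.dvd_of_mem_primeFactors hp
  have hpp := Nat.prime_of_mem_primeFactors hp
  have := Fact.mk hpp
  have hp2 : p ≠ 2 := by
    rintro rfl
    exact (Nat.not_even_iff_odd.2 hodd) (even_iff_two_dvd.2 hpm)
  obtain ⟨w, hw⟩ := exists_quadratic_not_isSquare hp2 (a := 1) (b := (t : ZMod p)) (c := 1)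
    one_ne_zero (fun h => hpt (by
      rw [← ZMod.intCast_zmod_eq_zero_iff_dvd]
      push_cast
      rw [← h]
      ring))
  obtain ⟨a, rfl⟩ := ZMod.intCast_surjective w
  have hr : jacobiSym (1 + E p * (a ^ 2 + t * a)) m = -1 := by
    have hm' : m / p ≠ 0 := (Nat.div_pos (Nat.le_of_dvd (NeZero.pos m) hpm) hpp.pos).ne'
    have : NeZero (m / p) := ⟨hm'⟩
    have hmul : m = p * (m / p) := (Nat.mul_div_cancel' hpm).symm
    have e1 : jacobiSym (1 + E p * (a ^ 2 + t * a)) p = -1 := by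
      rw [ZMod.nonsquare_iff_jacobiSym_eq_neg_one]
      have hE1 : ((E p : ℤ) : ZMod p) = 1 := by
        have := (ZMod.intCast_zmod_eq_zero_iff_dvd _ _).2 h1
        push_cast at this
        exact sub_eq_zero.1 this
      rw [Int.cast_add, Int.cast_mul, hE1]
      push_cast
      convert hw using 2
      ring
    have e2 : jacobiSym (1 + E p * (a ^ 2 + t * a)) (m / p) = 1 := by
      rw [← jacobiSym_val, Int.cast_add, Int.cast_mul, (ZMod.intCast_zmod_eq_zero_iff_dvd _ _).2 h2,
        zero_mul, add_zero, jacobiSym_val, jacobiSym.one_left]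
    have e3 := jacobiSym.mul_right (1 + E p * (a ^ 2 + t * a)) p (m / p)
    rwa [← hmul, e1, e2, mul_one] at e3
  have hu : IsUnit (((1 + E p * (a ^ 2 + t * a) : ℤ)) : ZMod m) := by
    have hg : IsCoprime (1 + E p * (a ^ 2 + t * a)) (m : ℤ) := by
      by_contra h
      rw [Int.isCoprime_iff_gcd_eq_one, ← ne_eq, ← jacobiSym.eq_zero_iff_not_coprime, hr] at h
      exact absurd h (by decide)
    have := hg.map (Int.castRingHom (ZMod m))
    simpa [isCoprime_zero_right] using this
  obtain ⟨r, hr'⟩ := hu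
  refine ⟨r, 1 + E p * (a - 1), E p, ?_, ?_⟩
  · change ((jacobiSym _ m : ℤ) : ℂ) = -1
    rw [hr', jacobiSym_val, hr]
    simp
  · rw [hr']
    push_cast
    linear_combination ((a : ZMod m) ^ 2 - 2 * a + 2 + t * a - t) * idempotent_mul_self hp h1 h2

end Arithmetic

theorem isPrimitive_of_injective {R : Type*} [CommRing R] {ψ : AddChar R ℂ}
    (hψ : Function.Injective ψ) : ψ.IsPrimitive := fun a ha h => ha <| hψ <| by
  rw [AddChar.map_zero_eq_one, ← mul_one a, ← AddChar.mulShift_apply, h, AddChar.one_apply]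

namespace TorusCyclic

section Gauss

variable {R : Type*} [CommRing R] {ψ : AddChar R ℂ} {V : Type*} [AddCommGroup V]
    [Module ℂ V] {ρ : SL(2, R) →* Module.End ℂ V} (D : TorusCyclic ψ ρ)

theorem exists_conj_companion {τ u v : R} {r : Rˣ} (h : u ^ 2 + τ * u * v + v ^ 2 = r) (x : Rˣ) :
    ∃ g : SL(2, R), g * companion τ x = companion τ (r * x) * g := by
  have hr := r.mul_inv
  have hx := x.mul_inv
  obtain ⟨g, hg⟩ : ∃ g : SL(2, R), g.1 =
      !![(v * τ + u) * ((r⁻¹ : Rˣ) : R), -(v * ((r⁻¹ : Rˣ) : R) * ((x⁻¹ : Rˣ) : R)); x * v, u] := by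
    refine ⟨⟨_, ?_⟩, rfl⟩
    rw [Matrix.det_fin_two_of]
    linear_combination ((r⁻¹ : Rˣ) : R) * h + hr + v ^ 2 * ((r⁻¹ : Rˣ) : R) * hx
  refine ⟨g, ?_⟩
  apply ext_entries <;> simp [mul_entry, companion_val, hg]
  · linear_combination (v * ((r⁻¹ : Rˣ) : R)) * hx
  · ring
  · linear_combination (- (u : R) - v * τ) * (x : R) * hr
  · linear_combination v * ((1 : R) - (r : R) * ((r⁻¹ : Rˣ) : R)) * hx - v * hr

variable [Fintype R] [DecidableEq R]

/-- The twisted Fourier transform of the matrix coefficients of `S`. -/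
def gauss (η : Rˣ →* ℂ) (τ : R) : ℂ := ∑ x : Rˣ, η x * D.coeff x * ψ (τ * (x⁻¹ : Rˣ))

variable {η : Rˣ →* ℂ}

theorem sum_trace_companion [FiniteDimensional ℂ V] (hψ : Function.Injective ψ)
    (hη : ∀ x, η (x ^ 2) = 1) (τ : R) :
    rootCount R * ∑ x : Rˣ, η x * LinearMap.trace ℂ V (ρ (companion τ x)) =
      Fintype.card Rˣ * D.gauss η τ := by
  have h1 : ∀ b : Rˣ, ∑ x : Rˣ, η x * (ψ (τ * ((x * b ^ 2)⁻¹ : Rˣ)) * D.coeff (x * b ^ 2)) =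
      D.gauss η τ := fun b => by
    rw [gauss]
    conv_rhs => rw [← Equiv.sum_comp (Equiv.mulRight (b ^ 2))]
    refine Finset.sum_congr rfl fun x _ => ?_
    rw [Equiv.coe_mulRight, map_mul η, hη]
    ring
  simp_rw [Finset.mul_sum, mul_left_comm (rootCount R), D.trace_companion hψ, Finset.mul_sum]
  rw [Finset.sum_comm, Finset.sum_congr rfl fun b _ => h1 b, Finset.sum_const, nsmul_eq_mul,
    Finset.card_univ]

theorem gauss_eq_zero [FiniteDimensional ℂ V] (hψ : Function.Injective ψ)
    (hη : ∀ x, η (x ^ 2) = 1) {τ u v : R} {r : Rˣ} (hr : η r = -1)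
    (h : u ^ 2 + τ * u * v + v ^ 2 = r) : D.gauss η τ = 0 := by
  have ht : ∀ x, LinearMap.trace ℂ V (ρ (companion τ (r * x))) =
      LinearMap.trace ℂ V (ρ (companion τ x)) := fun x => by
    obtain ⟨g, hg⟩ := exists_conj_companion h x
    rw [eq_mul_inv_of_mul_eq hg.symm, map_mul, LinearMap.trace_mul_comm, ← map_mul,
      inv_mul_cancel_left]
  have hs : ∑ x : Rˣ, η x * LinearMap.trace ℂ V (ρ (companion τ x)) = 0 := by
    rw [← self_eq_neg]
    conv_lhs => rw [← Equiv.sum_comp (Equiv.mulLeft r)]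
    rw [← Finset.sum_neg_distrib]
    refine Finset.sum_congr rfl fun x _ => ?_
    rw [Equiv.coe_mulLeft, ht, map_mul, hr]
    ring
  have := D.sum_trace_companion hψ hη τ
  rw [hs, mul_zero, eq_comm, mul_eq_zero, Nat.cast_eq_zero] at this
  exact this.resolve_left Fintype.card_ne_zero

theorem gauss_mul (τ : R) (u : Rˣ) (hu : u ^ 2 = 1) :
    D.gauss η (u * τ) = η u * D.chi u * D.gauss η τ := by
  rw [gauss, gauss, ← Equiv.sum_comp (Equiv.mulRight u), Finset.mul_sum]
  refine Finset.sum_congr rfl fun x _ => ?_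
  have h : (u : R) * τ * ((x * u)⁻¹ : Rˣ) = τ * (x⁻¹ : Rˣ) := by
    rw [mul_inv, Units.val_mul]
    linear_combination τ * ((x⁻¹ : Rˣ) : R) * u.mul_inv
  rw [Equiv.coe_mulRight, map_mul, D.coeff_mul _ _ hu, h]
  ring

theorem sum_gauss (hψ : Function.Injective ψ) (z : R) :
    ∑ τ, D.gauss η τ * ψ (-(τ * z)) =
      ∑ x : Rˣ, η x * D.coeff x * if ((x⁻¹ : Rˣ) : R) = z then Fintype.card R else 0 := by
  simp_rw [gauss, Finset.sum_mul]
  rw [Finset.sum_comm]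
  refine Finset.sum_congr rfl fun x _ => ?_
  have := AddChar.sum_mulShift (((x⁻¹ : Rˣ) : R) - z) (isPrimitive_of_injective hψ)
  simp_rw [sub_eq_zero] at this
  rw [← this, Finset.mul_sum]
  refine Finset.sum_congr rfl fun τ _ => ?_
  rw [mul_assoc, ← AddChar.map_add_eq_mul, mul_sub, sub_eq_add_neg]

end Gauss

end TorusCyclic

section Transfer

namespace TorusCyclic

variable {R : Type*} [CommRing R] {ψ : AddChar R ℂ}
    {V : Type*} [AddCommGroup V] [Module ℂ V] {ρ : SL(2, R) →* Module.End ℂ V}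
    {V' : Type*} [AddCommGroup V'] [Module ℂ V'] {ρ' : SL(2, R) →* Module.End ℂ V'}
    (D : TorusCyclic ψ ρ) (D' : TorusCyclic ψ ρ') [Fintype R] [DecidableEq R]

/-- The linear map matching the torus orbits of the two distinguished vectors. -/
noncomputable def transfer : V →ₗ[ℂ] V' :=
  (rootCount R)⁻¹ • ∑ b : Rˣ, (D.P ∘ₗ ρ (dMat b⁻¹)).smulRight (ρ' (dMat b) D'.v)

variable {D D'}

theorem transfer_d (hψ : Function.Injective ψ)
    (hchi : ∀ u : Rˣ, u ^ 2 = 1 → D.chi u = D'.chi u) (a : Rˣ) :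
    D.transfer D' (ρ (dMat a) D.v) = ρ' (dMat a) D'.v := by
  rw [transfer, LinearMap.smul_apply, LinearMap.sum_apply, inv_smul_eq_iff₀ rootCount_ne_zero]
  exact D.sum_transfer hψ D' hchi a

theorem transfer_comp_d (hψ : Function.Injective ψ)
    (hchi : ∀ u : Rˣ, u ^ 2 = 1 → D.chi u = D'.chi u) (a : Rˣ) :
    D.transfer D' ∘ₗ ρ (dMat a) = ρ' (dMat a) ∘ₗ D.transfer D' := by
  refine D.hom_ext fun b => ?_
  rw [LinearMap.comp_apply, LinearMap.comp_apply, transfer_d hψ hchi, ← map_mul_apply,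
    ← map_mul_apply, ← dMat_mul, transfer_d hψ hchi]

theorem transfer_comp_T (hψ : Function.Injective ψ)
    (hchi : ∀ u : Rˣ, u ^ 2 = 1 → D.chi u = D'.chi u) (x : R) :
    D.transfer D' ∘ₗ ρ (tMat x) = ρ' (tMat x) ∘ₗ D.transfer D' := by
  refine D.hom_ext fun b => ?_
  rw [LinearMap.comp_apply, LinearMap.comp_apply, transfer_d hψ hchi, T_d, T_d, map_smul,
    transfer_d hψ hchi]

theorem transfer_comp_S (hψ : Function.Injective ψ)
    (hchi : ∀ u : Rˣ, u ^ 2 = 1 → D.chi u = D'.chi u) {c : ℂ}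
    (hc : ∀ x, D.coeff x = c * D'.coeff x) :
    D.transfer D' ∘ₗ ρ (sMat R) = c • (ρ' (sMat R) ∘ₗ D.transfer D') := by
  have hv : D.transfer D' (ρ (sMat R) D.v) = c • ρ' (sMat R) D'.v := by
    apply smul_right_injective _ (rootCount_ne_zero (R := R))
    change rootCount R • _ = rootCount R • _
    rw [← map_smul, D.S_d_v hψ, smul_comm, D'.S_d_v hψ, map_sum, Finset.smul_sum]
    refine Finset.sum_congr rfl fun b _ => ?_
    rw [map_smul, transfer_d hψ hchi, hc, mul_smul]
  refine D.hom_ext fun b => ?_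
  have h := LinearMap.congr_fun (transfer_comp_d hψ hchi b⁻¹) (ρ (sMat R) D.v)
  simp only [LinearMap.comp_apply] at h
  rw [LinearMap.smul_apply, LinearMap.comp_apply, LinearMap.comp_apply, ← map_mul_apply,
    sMat_mul_dMat, map_mul_apply, h, hv, map_smul, ← map_mul_apply, ← sMat_mul_dMat,
    map_mul_apply, transfer_d hψ hchi]

/-- If the matrix coefficients of `S` are proportional, then the matching of torus orbits is an
isomorphism of representations, at least on generators. -/
theorem exists_equiv_of_coeff (hψ : Function.Injective ψ)
    (hchi : ∀ u : Rˣ, u ^ 2 = 1 → D.chi u = D'.chi u) {c : ℂ} (hc0 : c ≠ 0)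
    (hc : ∀ x, D.coeff x = c * D'.coeff x) :
    ∃ e : V ≃ₗ[ℂ] V', (∀ x w, e (ρ (tMat x) w) = ρ' (tMat x) (e w)) ∧
      ∀ w, e (ρ (sMat R) w) = ρ' (sMat R) (e w) := by
  have hchi' : ∀ u : Rˣ, u ^ 2 = 1 → D'.chi u = D.chi u := fun u hu => (hchi u hu).symm
  let e : V ≃ₗ[ℂ] V' := LinearEquiv.ofLinearMap (D.transfer D') (D'.transfer D)
    (D'.hom_ext fun a => by simp [transfer_d hψ hchi, transfer_d hψ hchi'])
    (D.hom_ext fun a => by simp [transfer_d hψ hchi, transfer_d hψ hchi'])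
  have hT : ∀ x w, e (ρ (tMat x) w) = ρ' (tMat x) (e w) := fun x w =>
    LinearMap.congr_fun (transfer_comp_T hψ hchi x) w
  have hS : ∀ w, e (ρ (sMat R) w) = c • ρ' (sMat R) (e w) := fun w =>
    LinearMap.congr_fun (transfer_comp_S hψ hchi hc) w
  have h1 : c = 1 := by
    have h2 : e (ρ ((sMat R * tMat 1) ^ 3) D.v) = e (ρ (sMat R ^ 2) D.v) := by
      rw [sMat_tMat_pow_three]
    have h3 : c ^ 3 • ρ' (sMat R ^ 2) (e D.v) = c ^ 2 • ρ' (sMat R ^ 2) (e D.v) := by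
      rw [pow_two (sMat R), map_mul_apply, hS, hS, map_smul, smul_smul, ← pow_two,
        ← map_mul_apply, ← pow_two] at h2
      rw [← h2]
      conv_lhs => rw [← sMat_tMat_pow_three]
      simp only [pow_succ, pow_zero, one_mul, map_mul_apply, hS, hT, map_smul, smul_smul, mul_assoc]
    have h4 : ρ' (sMat R ^ 2) (e D.v) ≠ 0 := fun h => by
      have h5 : ρ' ((sMat R ^ 2)⁻¹) (ρ' (sMat R ^ 2) (e D.v)) = e D.v := by
        rw [← map_mul_apply, inv_mul_cancel, map_one, Module.End.one_apply]
      rw [h, map_zero] at h5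
      exact D.v_ne_zero (e.map_eq_zero_iff.1 h5.symm)
    have h6 := smul_left_injective _ h4 h3
    rw [pow_succ] at h6
    exact mul_left_cancel₀ (pow_ne_zero 2 hc0) (h6.trans (mul_one _).symm)
  subst h1
  exact ⟨e, hT, fun w => by rw [hS, one_smul]⟩

end TorusCyclic

end Transfer

section OddSquarefree

namespace TorusCyclic

theorem isUnit_two {m : ℕ} (hodd : Odd m) : IsUnit (2 : ZMod m) := by
  have := (ZMod.isUnit_iff_coprime 2 m).2 (Nat.coprime_two_left.2 hodd)
  exact_mod_cast this

theorem exists_eq_unit_mul_two {m : ℕ} (hodd : Odd m) {τ : ZMod m} (hτ : τ ^ 2 = 4) :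
    ∃ u : (ZMod m)ˣ, u ^ 2 = 1 ∧ τ = u * 2 := by
  obtain ⟨t, ht⟩ := isUnit_two hodd
  have ht' := t.mul_inv
  rw [ht] at ht'
  have h1 : (τ * ((t⁻¹ : (ZMod m)ˣ) : ZMod m)) * (τ * ((t⁻¹ : (ZMod m)ˣ) : ZMod m)) = 1 := by
    linear_combination ((t⁻¹ : (ZMod m)ˣ) : ZMod m) ^ 2 * hτ +
      (2 * ((t⁻¹ : (ZMod m)ˣ) : ZMod m) + 1) * ht'
  refine ⟨⟨_, _, h1, h1⟩, ?_, ?_⟩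
  · rw [pow_two]; exact Units.ext h1
  · change τ = τ * ((t⁻¹ : (ZMod m)ˣ) : ZMod m) * 2
    linear_combination (-τ) * ht'

variable {m : ℕ} [NeZero m] {ψ : AddChar (ZMod m) ℂ}
    {V : Type*} [AddCommGroup V] [Module ℂ V] {ρ : SL(2, ZMod m) →* Module.End ℂ V}
    (D : TorusCyclic ψ ρ)

theorem jacobiChar_ne_zero (x : (ZMod m)ˣ) : jacobiChar m x ≠ 0 := fun h => by
  have := jacobiChar_sq x
  rw [map_pow, h] at this
  simp at this

theorem gauss_eq_zero_of_sq_ne [FiniteDimensional ℂ V] (hodd : Odd m) (hm : Squarefree m)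
    (hψ : Function.Injective ψ) {τ : ZMod m} (hτ : τ ^ 2 ≠ 4) :
    D.gauss (jacobiChar m) τ = 0 := by
  obtain ⟨r, u, v, hr, h⟩ := exists_jacobiChar_eq_neg_one hodd hm τ hτ
  exact D.gauss_eq_zero hψ jacobiChar_sq hr h

theorem coeff_eq_sum_gauss (hψ : Function.Injective ψ) (y : (ZMod m)ˣ) :
    ∑ τ, D.gauss (jacobiChar m) τ * ψ (-(τ * (y⁻¹ : (ZMod m)ˣ))) =
      m * jacobiChar m y * D.coeff y := by
  rw [D.sum_gauss hψ, Finset.sum_eq_single y]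
  · rw [if_pos rfl, ZMod.card]; ring
  · intro x _ hx
    rw [if_neg (fun h => hx (inv_injective (Units.ext h))), Nat.cast_zero, mul_zero]
  · simp

theorem sum_gauss_eq_zero (hψ : Function.Injective ψ) {z : ZMod m} (hz : ¬ IsUnit z) :
    ∑ τ, D.gauss (jacobiChar m) τ * ψ (-(τ * z)) = 0 := by
  rw [D.sum_gauss hψ]
  refine Finset.sum_eq_zero fun x _ => ?_
  have hx : ((x⁻¹ : (ZMod m)ˣ) : ZMod m) ≠ z := fun h => hz (h ▸ Units.isUnit _)
  rw [if_neg hx, Nat.cast_zero, mul_zero]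

theorem coeff_eq_zero_of_gauss (hψ : Function.Injective ψ)
    (h : ∀ τ, D.gauss (jacobiChar m) τ = 0) (x : (ZMod m)ˣ) : D.coeff x = 0 := by
  have h1 := D.coeff_eq_sum_gauss hψ x
  simp only [h, zero_mul, Finset.sum_const_zero] at h1
  have h2 : (m : ℂ) * jacobiChar m x ≠ 0 :=
    mul_ne_zero (Nat.cast_ne_zero.2 (NeZero.ne m)) (jacobiChar_ne_zero x)
  exact (mul_eq_zero.1 h1.symm).resolve_left h2

theorem gauss_two_ne_zero [FiniteDimensional ℂ V] (hodd : Odd m) (hm : Squarefree m)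
    (hψ : Function.Injective ψ) : D.gauss (jacobiChar m) 2 ≠ 0 := by
  intro h
  have h1 := D.coeff_eq_zero_of_gauss hψ fun τ => by
    by_cases hτ : τ ^ 2 = 4
    · obtain ⟨u, hu, rfl⟩ := exists_eq_unit_mul_two hodd hτ
      rw [D.gauss_mul _ _ hu, h, mul_zero]
    · exact D.gauss_eq_zero_of_sq_ne hodd hm hψ hτ
  have h2 := D.S_d_v hψ
  simp only [h1, zero_smul, Finset.sum_const_zero] at h2
  have h3 := (smul_eq_zero.1 h2).resolve_left rootCount_ne_zero
  have h4 : ρ (sMat (ZMod m))⁻¹ (ρ (sMat (ZMod m)) D.v) = D.v := by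
    rw [← map_mul_apply, inv_mul_cancel, map_one, Module.End.one_apply]
  rw [h3, map_zero] at h4
  exact D.v_ne_zero h4.symm

/-- The value of `chi` at the reflection `1 - 2 e`, for a primitive idempotent `e`. -/
theorem chi_reflection [FiniteDimensional ℂ V] (hodd : Odd m) (hm : Squarefree m)
    (hψ : Function.Injective ψ) {p : ℕ} (hp : p ∈ m.primeFactors) {E : ℤ}
    (h1 : (p : ℤ) ∣ E - 1) (h2 : ((m / p : ℕ) : ℤ) ∣ E) {u : (ZMod m)ˣ}
    (hu : (u : ZMod m) = 1 - 2 * E) : jacobiChar m u * D.chi u = -1 := by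
  have hpp := Nat.prime_of_mem_primeFactors hp
  have hp2 : p ≠ 2 := by
    rintro rfl
    exact (Nat.not_even_iff_odd.2 hodd) (even_iff_two_dvd.2 (Nat.dvd_of_mem_primeFactors hp))
  have hpi : Prime (p : ℤ) := Nat.prime_iff_prime_int.1 hpp
  have hp2' : ¬ (p : ℤ) ∣ 2 := fun h => hp2 <| by
    have h' : p ∣ 2 := by exact_mod_cast h
    exact (Nat.prime_dvd_prime_iff_eq hpp Nat.prime_two).1 h'
  have hE := idempotent_mul_self hp h1 h2
  have hE0 : (E : ZMod m) ≠ 0 := fun h => by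
    have := (idempotent_mul_eq_zero_iff hp h1 h2 1).1 (by rw [h, zero_mul])
    exact hpi.not_isUnit (isUnit_of_dvd_one this)
  have hE4 : (2 : ZMod m) ≠ 2 - 4 * E := fun h => by
    have h3 : (p : ℤ) ∣ 2 * 2 := (idempotent_mul_eq_zero_iff hp h1 h2 _).1
      (by push_cast; linear_combination h)
    exact (hpi.dvd_or_dvd h3).elim hp2' hp2'
  have hz : ∀ z : ZMod m, ¬ IsUnit ((1 - (E : ZMod m)) * z) := fun z h => hE0 <| by
    have h3 : (E : ZMod m) * ((1 - (E : ZMod m)) * z) = 0 := by linear_combination (-z) * hE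
    exact h.mul_left_eq_zero.1 h3
  have hu2 : u ^ 2 = 1 := Units.ext <| by
    rw [Units.val_pow_eq_pow_val, hu, Units.val_one]
    linear_combination 4 * hE
  have hsum : ∑ z : ZMod m, (∑ τ, D.gauss (jacobiChar m) τ *
      ψ (-(τ * ((1 - (E : ZMod m)) * z)))) * ψ (z * (2 * (1 - (E : ZMod m)))) = 0 :=
    Finset.sum_eq_zero fun z _ => by rw [D.sum_gauss_eq_zero hψ (hz z), zero_mul]
  simp_rw [Finset.sum_mul] at hsum
  rw [Finset.sum_comm] at hsum
  have hτ : ∀ τ : ZMod m, ∑ z : ZMod m, D.gauss (jacobiChar m) τ *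
      ψ (-(τ * ((1 - (E : ZMod m)) * z))) * ψ (z * (2 * (1 - (E : ZMod m)))) =
      m * if (2 - τ) * (1 - (E : ZMod m)) = 0 then D.gauss (jacobiChar m) τ else 0 := fun τ => by
    have := AddChar.sum_mulShift ((2 - τ) * (1 - (E : ZMod m))) (isPrimitive_of_injective hψ)
    rw [ZMod.card] at this
    trans D.gauss (jacobiChar m) τ * ∑ z : ZMod m, ψ (z * ((2 - τ) * (1 - (E : ZMod m))))
    · rw [Finset.mul_sum]
      refine Finset.sum_congr rfl fun z _ => ?_
      rw [mul_assoc, ← AddChar.map_add_eq_mul]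
      congr 2
      ring
    · rw [this]
      split_ifs <;> push_cast <;> ring
  simp_rw [hτ] at hsum
  rw [← Finset.mul_sum, mul_eq_zero] at hsum
  replace hsum := hsum.resolve_left (Nat.cast_ne_zero.2 (NeZero.ne m))
  rw [← Finset.sum_subset (Finset.subset_univ {2, 2 - 4 * (E : ZMod m)}), Finset.sum_pair hE4,
    if_pos (by ring), if_pos (by linear_combination (-4) * hE)] at hsum
  · have h5 : (2 - 4 * (E : ZMod m)) = u * 2 := by rw [hu]; ring
    rw [h5, D.gauss_mul _ _ hu2] at hsum
    have h6 := D.gauss_two_ne_zero hodd hm hψ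
    refine mul_right_cancel₀ h6 ?_
    linear_combination hsum
  · intro τ _ hτ'
    rw [ite_eq_right_iff]
    intro h3
    by_contra h4
    have h5 : τ ^ 2 = 4 := by
      by_contra h
      exact h4 (D.gauss_eq_zero_of_sq_ne hodd hm hψ h)
    refine hτ' ?_
    obtain ⟨t, rfl⟩ := ZMod.intCast_surjective τ
    have h6 : (p : ℤ) ∣ (t - 2) * (t + 2) := (idempotent_mul_eq_zero_iff hp h1 h2 _).1 (by
      push_cast
      linear_combination (E : ZMod m) * h5)
    rw [Finset.mem_insert, Finset.mem_singleton]
    rcases hpi.dvd_or_dvd h6 with h | h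
    · left
      have := (idempotent_mul_eq_zero_iff hp h1 h2 _).2 h
      push_cast at this
      linear_combination this - h3
    · right
      have := (idempotent_mul_eq_zero_iff hp h1 h2 _).2 h
      push_cast at this
      linear_combination this - h3

variable {V' : Type*} [AddCommGroup V'] [Module ℂ V'] {ρ' : SL(2, ZMod m) →* Module.End ℂ V'}
    (D' : TorusCyclic ψ ρ')

theorem chi_eq_chi [FiniteDimensional ℂ V] [FiniteDimensional ℂ V'] (hodd : Odd m)
    (hm : Squarefree m) (hψ : Function.Injective ψ) (u : (ZMod m)ˣ) (hu : u ^ 2 = 1) :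
    D.chi u = D'.chi u := by
  classical
  obtain ⟨E, hE⟩ := exists_idempotents hm
  induction hk : (m.primeFactors.filter fun p => (E p : ZMod m) * (u - 1) ≠ 0).card
    using Nat.strong_induction_on generalizing u with
  | _ k ih =>
  obtain ⟨t, ht⟩ := ZMod.intCast_surjective (u : ZMod m)
  have hpt : ∀ p ∈ m.primeFactors, (E p : ZMod m) * (u - 1) = 0 ↔ (p : ℤ) ∣ t - 1 := fun p hp => by
    rw [← idempotent_mul_eq_zero_iff hp (hE p hp).1 (hE p hp).2, ← ht]
    push_cast
    rfl
  by_cases h : ∃ p ∈ m.primeFactors, (E p : ZMod m) * (u - 1) ≠ 0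
  · obtain ⟨p, hp, hpu⟩ := h
    obtain ⟨h1, h2⟩ := hE p hp
    have hEE := idempotent_mul_self hp h1 h2
    have h3 : (1 - 2 * (E p : ZMod m)) * (1 - 2 * (E p : ZMod m)) = 1 := by
      linear_combination 4 * hEE
    let w : (ZMod m)ˣ := ⟨_, _, h3, h3⟩
    have hw : (w : ZMod m) = 1 - 2 * E p := rfl
    have hw2 : w ^ 2 = 1 := Units.ext (by rw [pow_two]; exact h3)
    have hpp := Nat.prime_iff_prime_int.1 (Nat.prime_of_mem_primeFactors hp)
    have h4 : (p : ℤ) ∣ (t - 1) * (t + 1) := (idempotent_mul_eq_zero_iff hp h1 h2 _).1 (by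
      have := congrArg Units.val hu
      rw [Units.val_pow_eq_pow_val, Units.val_one, ← ht] at this
      push_cast
      linear_combination (E p : ZMod m) * this)
    have h5 := (idempotent_mul_eq_zero_iff hp h1 h2 _).2
      ((hpp.dvd_or_dvd h4).resolve_left (fun h => hpu ((hpt p hp).2 h)))
    push_cast at h5
    rw [ht] at h5
    have h6 : D.chi (u * w) = D'.chi (u * w) := by
      refine ih _ ?_ (u * w) (by rw [mul_pow, hu, hw2, one_mul]) rfl
      rw [← hk]
      refine Finset.card_lt_card (Finset.ssubset_iff_of_subset ?_ |>.2 ⟨p, ?_, ?_⟩)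
      · intro q
        simp only [Finset.mem_filter]
        rintro ⟨hq, hqu⟩
        refine ⟨hq, fun h => hqu ?_⟩
        have hqp : q ≠ p := by
          rintro rfl
          exact hpu h
        have hEq : (E q : ZMod m) * E p = 0 := by
          rw [idempotent_mul_eq_zero_iff hq (hE q hq).1 (hE q hq).2]
          refine dvd_trans (Int.natCast_dvd_natCast.2 ?_) h2
          have hqq := Nat.prime_of_mem_primeFactors hq
          have h7 := Nat.dvd_of_mem_primeFactors hq
          rw [← Nat.mul_div_cancel' (Nat.dvd_of_mem_primeFactors hp)] at h7
          exact (hqq.dvd_mul.1 h7).resolve_left fun h8 => hqp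
            ((Nat.prime_dvd_prime_iff_eq hqq (Nat.prime_of_mem_primeFactors hp)).1 h8)
        rw [Units.val_mul, hw]
        linear_combination h - 2 * (u : ZMod m) * hEq
      · simp [hp, hpu]
      · simp only [Finset.mem_filter, not_and, not_not]
        intro _
        rw [Units.val_mul, hw]
        linear_combination (-1 : ZMod m) * h5 - 2 * (u : ZMod m) * hEE
    rw [D.chi_mul _ _ hw2, D'.chi_mul _ _ hw2] at h6
    have h7 := D.chi_reflection hodd hm hψ hp h1 h2 hw
    have h8 := D'.chi_reflection hodd hm hψ hp h1 h2 hw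
    have h9 : D.chi w = D'.chi w :=
      mul_left_cancel₀ (jacobiChar_ne_zero w) (h7.trans h8.symm)
    rw [h9] at h6
    refine mul_right_cancel₀ (fun h0 => ?_) h6
    rw [h0, mul_zero] at h8
    norm_num at h8
  · push Not at h
    have h1 := intCast_eq_zero_of_primes hm (t - 1) fun p hp => (hpt p hp).1 (h p hp)
    push_cast at h1
    rw [ht, sub_eq_zero, Units.val_eq_one] at h1
    rw [h1, D.chi_one, D'.chi_one]

include D' D in
/-- At odd squarefree level, a torus-cyclic representation is determined by its character. -/
theorem exists_equiv_of_odd_squarefree [FiniteDimensional ℂ V] [FiniteDimensional ℂ V']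
    (hodd : Odd m) (hm : Squarefree m) (hψ : Function.Injective ψ) :
    ∃ e : V ≃ₗ[ℂ] V', (∀ x w, e (ρ (tMat x) w) = ρ' (tMat x) (e w)) ∧
      ∀ w, e (ρ (sMat (ZMod m)) w) = ρ' (sMat (ZMod m)) (e w) := by
  have hchi := D.chi_eq_chi D' hodd hm hψ
  have hg := D.gauss_two_ne_zero hodd hm hψ
  have hg' := D'.gauss_two_ne_zero hodd hm hψ
  set c := D.gauss (jacobiChar m) 2 / D'.gauss (jacobiChar m) 2 with hc
  have hτ : ∀ τ, D.gauss (jacobiChar m) τ = c * D'.gauss (jacobiChar m) τ := fun τ => by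
    by_cases hτ : τ ^ 2 = 4
    · obtain ⟨u, hu, rfl⟩ := exists_eq_unit_mul_two hodd hτ
      rw [D.gauss_mul _ _ hu, D'.gauss_mul _ _ hu, hchi u hu, hc]
      field_simp
    · rw [D.gauss_eq_zero_of_sq_ne hodd hm hψ hτ, D'.gauss_eq_zero_of_sq_ne hodd hm hψ hτ, mul_zero]
  refine exists_equiv_of_coeff (D := D) (D' := D') hψ hchi (div_ne_zero hg hg') fun x => ?_
  have h1 := D.coeff_eq_sum_gauss hψ x
  simp only [hτ, mul_assoc c] at h1
  rw [← Finset.mul_sum, D'.coeff_eq_sum_gauss hψ x] at h1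
  have h2 : (m : ℂ) * jacobiChar m x ≠ 0 :=
    mul_ne_zero (Nat.cast_ne_zero.2 (NeZero.ne m)) (jacobiChar_ne_zero x)
  refine mul_left_cancel₀ h2 ?_
  rw [← h1]
  ring

end TorusCyclic

end OddSquarefree

section Levels

theorem exists_eigenvector_mem {V : Type*} [AddCommGroup V] [Module ℂ V] [FiniteDimensional ℂ V]
    {U : Submodule ℂ V} (hU : U ≠ ⊥) (f : Module.End ℂ V) (hf : ∀ w ∈ U, f w ∈ U) :
    ∃ w ∈ U, w ≠ 0 ∧ ∃ c : ℂ, f w = c • w := by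
  have := Submodule.nontrivial_iff_ne_bot.2 hU
  obtain ⟨c, hc⟩ := Module.End.exists_eigenvalue (f.restrict hf)
  obtain ⟨w, hw⟩ := hc.exists_hasEigenvector
  refine ⟨w, w.2, fun h => hw.2 (Subtype.ext h), c, ?_⟩
  exact congrArg Subtype.val hw.apply_eq_smul

/-- The element `1 + h [[α, β], [γ, -α]]`, for `h² = 0`. -/
def kMat {R : Type*} [CommRing R] {h : R} (hh : h ^ 2 = 0) (α β γ : R) : SL(2, R) :=
  ⟨!![1 + h * α, h * β; h * γ, 1 - h * α], by
    rw [Matrix.det_fin_two_of]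
    linear_combination (-(α ^ 2) - β * γ) * hh⟩

theorem kMat_val {R : Type*} [CommRing R] {h : R} (hh : h ^ 2 = 0) (α β γ : R) :
    (kMat hh α β γ).1 = !![1 + h * α, h * β; h * γ, 1 - h * α] := rfl

theorem kMat_mul {R : Type*} [CommRing R] {h : R} (hh : h ^ 2 = 0) (α β γ α' β' γ' : R) :
    kMat hh α β γ * kMat hh α' β' γ' = kMat hh (α + α') (β + β') (γ + γ') := by
  apply ext_entries <;> simp [mul_entry, kMat_val]
  · linear_combination (α * α' + β * γ') * hh
  · linear_combination (α * β' - β * α') * hh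
  · linear_combination (γ * α' - α * γ') * hh
  · linear_combination (γ * β' + α * α') * hh

theorem kMat_pow {R : Type*} [CommRing R] {h : R} (hh : h ^ 2 = 0) (α β γ : R) (k : ℕ) :
    kMat hh α β γ ^ k = kMat hh (k * α) (k * β) (k * γ) := by
  induction k with
  | zero => apply ext_entries <;> simp [kMat_val]
  | succ k ih =>
    rw [pow_succ, ih, kMat_mul]
    push_cast
    congr 1 <;> ring

theorem kMat_eq_tMat {R : Type*} [CommRing R] {h : R} (hh : h ^ 2 = 0) :
    kMat hh 0 1 0 = tMat h := by
  apply ext_entries <;> simp [kMat_val, tMat_val]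

theorem kMat_eq_sMat_conj {R : Type*} [CommRing R] {h : R} (hh : h ^ 2 = 0) :
    kMat hh 0 0 (-1) = sMat R * tMat h * (sMat R)⁻¹ := by
  apply ext_entries <;> simp [mul_entry, kMat_val, tMat_val, sMat_val]

theorem kMat_eq_conj {R : Type*} [CommRing R] {h : R} (hh : h ^ 2 = 0) (u : R) :
    kMat hh (-u) (u ^ 2) (-1) = (tMat u * sMat R) * tMat h * (tMat u * sMat R)⁻¹ := by
  apply ext_entries <;> simp [mul_entry, kMat_val, tMat_val, sMat_val] <;> ring

namespace TorusCyclic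

variable {R : Type*} [CommRing R] {ψ : AddChar R ℂ} {V : Type*} [AddCommGroup V]
    [Module ℂ V] {ρ : SL(2, R) →* Module.End ℂ V} (D : TorusCyclic ψ ρ)

include D in
theorem eigenvalue_conj_T [Fintype R] [DecidableEq R] (hψ : Function.Injective ψ) (g : SL(2, R))
    (h : R) {w : V} (hw : w ≠ 0) {c : ℂ} (hc : ρ (g * tMat h * g⁻¹) w = c • w) :
    ∃ b : Rˣ, c = ψ (h * ((b ^ 2 : Rˣ) : R)) := by
  have h1 : ρ (tMat h) (ρ g⁻¹ w) = c • ρ g⁻¹ w := by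
    rw [← map_smul, ← hc, ← map_mul_apply, ← map_mul_apply]
    congr 2
    group
  have h2 : ρ g⁻¹ w ≠ 0 := fun h0 => hw <| by
    rw [← one_smul ℂ w]
    have : ρ g (ρ g⁻¹ w) = w := by
      rw [← map_mul_apply, mul_inv_cancel, map_one, Module.End.one_apply]
    rw [one_smul, ← this, h0, map_zero]
  obtain ⟨b, hb⟩ : ∃ b : Rˣ, D.P (ρ (dMat b⁻¹) (ρ g⁻¹ w)) ≠ 0 := by
    by_contra! hb
    have h3 := D.resolution hψ (ρ g⁻¹ w)
    simp only [hb, zero_smul, Finset.sum_const_zero] at h3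
    exact h2 ((smul_eq_zero.1 h3.symm).resolve_left rootCount_ne_zero)
  refine ⟨b⁻¹, ?_⟩
  have h4 := D.P_d_T h b⁻¹ (ρ g⁻¹ w)
  rw [h1, map_smul, map_smul, smul_eq_mul] at h4
  exact mul_right_cancel₀ hb h4

include D in
/-- The level is not divisible by the square of an odd prime. -/
theorem false_of_odd_prime_sq [Fintype R] [DecidableEq R] [FiniteDimensional ℂ V]
    (hψ : Function.Injective ψ) {p : ℕ} [Fact p.Prime] (hp : p ≠ 2) {h : R} (hh : h ^ 2 = 0)
    (π : R →+* ZMod p) (hπ : ∀ x, h * x = 0 → π x = 0) : False := by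
  have comm : ∀ α β γ α' β' γ' w, ρ (kMat hh α β γ) (ρ (kMat hh α' β' γ') w) =
      ρ (kMat hh α' β' γ') (ρ (kMat hh α β γ) w) := fun α β γ α' β' γ' w => by
    rw [← map_mul_apply, ← map_mul_apply, kMat_mul, kMat_mul, add_comm α, add_comm β, add_comm γ]
  let U₁ : Submodule ℂ V := LinearMap.ker (ρ (kMat hh 0 1 0) - ψ h • LinearMap.id)
  have hU₁ : ∀ w, w ∈ U₁ ↔ ρ (kMat hh 0 1 0) w = ψ h • w := fun w => by
    simp [U₁, LinearMap.mem_ker, sub_eq_zero]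
  have hU₁0 : U₁ ≠ ⊥ := fun h0 => D.v_ne_zero <| by
    rw [← Submodule.mem_bot ℂ, ← h0, hU₁, kMat_eq_tMat, D.T_v]
  obtain ⟨w₁, hw₁U, hw₁0, s, hs⟩ := exists_eigenvector_mem hU₁0 (ρ (kMat hh 0 0 (-1)))
    fun w hw => by rw [hU₁] at hw ⊢; rw [comm, hw, map_smul]
  let U₂ : Submodule ℂ V := U₁ ⊓ LinearMap.ker (ρ (kMat hh 0 0 (-1)) - s • LinearMap.id)
  have hU₂ : ∀ w, w ∈ U₂ ↔ ρ (kMat hh 0 1 0) w = ψ h • w ∧ ρ (kMat hh 0 0 (-1)) w = s • w :=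
    fun w => by
      rw [Submodule.mem_inf, hU₁]
      simp [LinearMap.mem_ker, sub_eq_zero]
  have hU₂0 : U₂ ≠ ⊥ := fun h0 => hw₁0 <| by
    rw [← Submodule.mem_bot ℂ, ← h0, hU₂]
    exact ⟨(hU₁ _).1 hw₁U, hs⟩
  obtain ⟨w, hwU, hw0, μ, hμ⟩ := exists_eigenvector_mem hU₂0 (ρ (kMat hh (-1) 0 0))
    fun w hw => by
      rw [hU₂] at hw ⊢
      rw [comm, hw.1, map_smul, comm, hw.2, map_smul]
      exact ⟨rfl, rfl⟩
  obtain ⟨hw1, hw2⟩ := (hU₂ w).1 hwU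
  obtain ⟨c, hc⟩ := D.eigenvalue_conj_T hψ (sMat R) h hw0 (by rwa [← kMat_eq_sMat_conj hh])
  have hpow : ∀ (f : Module.End ℂ V) (z : ℂ), f w = z • w → ∀ k : ℕ, (f ^ k) w = z ^ k • w :=
    fun f z hf k => by
      induction k with
      | zero => simp
      | succ k ih => rw [pow_succ, Module.End.mul_apply, hf, map_smul, ih, smul_smul, pow_succ']
  have hu : ∀ u : ℕ, ∃ b : Rˣ, μ ^ u * ψ h ^ (u ^ 2) * s = ψ (h * ((b ^ 2 : Rˣ) : R)) := fun u => by
    refine D.eigenvalue_conj_T hψ (tMat (u : R) * sMat R) h hw0 ?_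
    have : kMat hh (-(u : R)) ((u : R) ^ 2) (-1) =
        kMat hh 0 0 (-1) * kMat hh 0 1 0 ^ (u ^ 2) * kMat hh (-1) 0 0 ^ u := by
      rw [kMat_pow, kMat_pow, kMat_mul, kMat_mul]
      push_cast
      congr 1 <;> ring
    rw [← kMat_eq_conj hh, this, map_mul_apply, map_mul_apply, map_pow, map_pow,
      hpow _ _ hμ, map_smul, hpow _ _ hw1, map_smul, map_smul, hw2, smul_smul, smul_smul]
  obtain ⟨f, hf⟩ := hu 1
  rw [pow_one, one_pow, pow_one] at hf
  have hμ' : μ = ψ (h * (((f ^ 2 : Rˣ) : R) - 1 - ((c ^ 2 : Rˣ) : R))) := by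
    rw [mul_sub, mul_sub, mul_one, AddChar.map_sub_eq_div, AddChar.map_sub_eq_div, ← hf, hc]
    have h1 : ψ h ≠ 0 := (AddChar.val_isUnit _ _).ne_zero
    have h2 : ψ (h * ((c ^ 2 : Rˣ) : R)) ≠ 0 := (AddChar.val_isUnit _ _).ne_zero
    field_simp
  set β := ((f ^ 2 : Rˣ) : R) - 1 - ((c ^ 2 : Rˣ) : R)
  have hq : ∀ x : ZMod p, ∃ y : ZMod p, y ≠ 0 ∧
      1 ^ 2 * x ^ 2 + π β * x + π ((c ^ 2 : Rˣ) : R) = y * y := fun x => by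
    obtain ⟨b, hb⟩ := hu x.val
    refine ⟨π b, (b.isUnit.map π).ne_zero, ?_⟩
    rw [hμ', hc, ← AddChar.map_nsmul_eq_pow, ← AddChar.map_nsmul_eq_pow, ← AddChar.map_add_eq_mul,
      ← AddChar.map_add_eq_mul] at hb
    have h1 := hπ ((x.val : R) ^ 2 + β * x.val + ((c ^ 2 : Rˣ) : R) - ((b ^ 2 : Rˣ) : R)) (by
      have h2 := hψ hb
      simp only [nsmul_eq_mul] at h2
      push_cast at h2 ⊢
      linear_combination h2)
    rw [map_sub, map_add, map_add, map_mul, map_pow, map_natCast, ZMod.natCast_zmod_val,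
      sub_eq_zero] at h1
    rw [one_pow, one_mul, h1, ← map_mul, ← pow_two, Units.val_pow_eq_pow_val]
  by_cases hβ : 4 * 1 ^ 2 * π ((c ^ 2 : Rˣ) : R) = π β ^ 2
  · obtain ⟨y, hy0, hy⟩ := hq (-(π β / 2))
    have h2 := two_ne_zero_zmod hp
    have h4 : (2 : ZMod p) ^ 2 * (y * y) = 0 := by
      rw [← hy]
      field_simp
      linear_combination hβ
    exact mul_ne_zero (pow_ne_zero 2 h2) (mul_ne_zero hy0 hy0) h4
  · obtain ⟨x, hx⟩ := exists_quadratic_not_isSquare hp one_ne_zero hβ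
    obtain ⟨y, -, hy⟩ := hq x
    exact hx ⟨y, hy⟩

include D in
/-- The level is not divisible by eight. -/
theorem false_of_eight (hψ : Function.Injective ψ) {h : R} {δ : Rˣ} (hδ : (δ : R) = 1 + h)
    (h4 : 4 * h = 0) (h2 : 2 * h ≠ 0) (hu : ∀ a : Rˣ, h * ((a ^ 2 : Rˣ) : R) = h) : False := by
  have hT : ∀ y w, ρ (tMat (h * y)) w = ψ (h * y) • w := fun y w => by
    have : ρ (tMat (h * y)) = ψ (h * y) • (LinearMap.id : V →ₗ[ℂ] V) := D.hom_ext fun a => by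
      rw [D.T_d, mul_right_comm, hu]
      rfl
    rw [this]
    rfl
  have hL : ∀ y w, ρ (sMat R * tMat (h * y) * (sMat R)⁻¹) w = ψ (h * y) • w := fun y w => by
    rw [map_mul_apply, map_mul_apply, hT, map_smul, ← map_mul_apply, mul_inv_cancel, map_one,
      Module.End.one_apply]
  have hmul := δ.mul_inv
  set w : R := ((δ⁻¹ : Rˣ) : R) with hw
  have key : tMat 1 * (sMat R * tMat (h * -1) * (sMat R)⁻¹) * tMat (-1) =
      (sMat R * tMat (h * -w) * (sMat R)⁻¹) * dMat δ * tMat (h * -w) := by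
    rw [hδ] at hmul
    apply ext_entries <;> simp [mul_entry, tMat_val, sMat_val, dMat_val, hδ, ← hw]
    · linear_combination (-h) * hmul
    · linear_combination (-h) * hmul
    · linear_combination (h ^ 2 * w - 1 + h) * hmul
  have hd : ∀ x, ρ (dMat δ) x = ψ (h * (2 * w - 1)) • x := fun x => by
    have h1 : ρ (tMat 1) (ρ (tMat (-1)) x) = x := by
      rw [← map_mul_apply, ← tMat_add, add_neg_cancel, tMat_zero, map_one, Module.End.one_apply]
    have h3 : ψ (h * -1) • x = ψ (h * -w) • ψ (h * -w) • ρ (dMat δ) x := by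
      have := congrArg (fun g => ρ g x) key
      rw [map_mul_apply (tMat 1 * _), map_mul_apply (tMat 1), hL, map_smul, h1,
        map_mul_apply (_ * dMat δ), map_mul_apply _ (dMat δ), hL, hT, map_smul] at this
      exact this
    have h5 := congrArg (fun y => ψ (h * w + h * w) • y) h3
    simp only [smul_smul, ← AddChar.map_add_eq_mul] at h5
    have e1 : h * w + h * w + (h * -w + h * -w) = 0 := by ring
    have e2 : h * w + h * w + h * -1 = h * (2 * w - 1) := by ring
    rw [e2, add_assoc] at h5
    rw [h5]
    have e3 : h * w + (h * w + (h * -w + h * -w)) = 0 := by ring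
    rw [e3, AddChar.map_zero_eq_one, one_smul]
  have hs : ρ (dMat δ) (ρ (sMat R) (ρ (dMat δ) D.v)) = ρ (sMat R) D.v := by
    rw [← map_mul_apply (sMat R), sMat_mul_dMat, map_mul_apply, ← map_mul_apply, ← dMat_mul,
      mul_inv_cancel, dMat_one, map_one, Module.End.one_apply]
  rw [hd D.v, map_smul, map_smul, hd, smul_smul, ← AddChar.map_add_eq_mul] at hs
  have hS : ρ (sMat R) D.v ≠ 0 := fun h0 => D.v_ne_zero <| by
    rw [← one_smul ℂ D.v, one_smul]
    have h1 : ρ (sMat R)⁻¹ (ρ (sMat R) D.v) = D.v := by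
      rw [← map_mul_apply, inv_mul_cancel, map_one, Module.End.one_apply]
    rw [← h1, h0, map_zero]
  have h1 := smul_left_injective ℂ hS (hs.trans (one_smul ℂ _).symm)
  rw [← ψ.map_zero_eq_one] at h1
  have h3 := hψ h1
  refine h2 ?_
  linear_combination w * h4 - h3

end TorusCyclic

end Levels

section LevelBounds

namespace TorusCyclic

variable {n : ℕ} [NeZero n] {ψ : AddChar (ZMod n) ℂ} {V : Type*} [AddCommGroup V]
    [Module ℂ V] {ρ : SL(2, ZMod n) →* Module.End ℂ V} (D : TorusCyclic ψ ρ)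

include D in
theorem not_prime_sq_dvd [FiniteDimensional ℂ V] (hψ : Function.Injective ψ) {p : ℕ}
    (hp : p.Prime) (hp2 : p ≠ 2) : ¬ p * p ∣ n := by
  rintro ⟨k, hk⟩
  have := Fact.mk hp
  have hpn : p ∣ n := ⟨p * k, by rw [hk, mul_assoc]⟩
  have h0 : ((p * p * k : ℕ) : ZMod n) = 0 := by rw [← hk, ZMod.natCast_self]
  push_cast at h0
  refine D.false_of_odd_prime_sq hψ hp2 (h := (p * k : ZMod n))
    (by linear_combination (k : ZMod n) * h0) (ZMod.castHom hpn (ZMod p)) fun x hx => ?_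
  obtain ⟨t, rfl⟩ := ZMod.intCast_surjective x
  rw [map_intCast, ZMod.intCast_zmod_eq_zero_iff_dvd]
  have h1 : (((p * k : ℤ) * t : ℤ) : ZMod n) = 0 := by push_cast; exact hx
  rw [ZMod.intCast_zmod_eq_zero_iff_dvd, hk] at h1
  push_cast at h1
  have hk0 : k ≠ 0 := by rintro rfl; exact NeZero.ne n (by rw [hk, mul_zero])
  refine (mul_dvd_mul_iff_left (a := (p * k : ℤ)) ?_).1 ?_
  · exact_mod_cast mul_ne_zero hp.ne_zero hk0
  · rwa [mul_right_comm]

include D in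
theorem not_eight_dvd (hψ : Function.Injective ψ) : ¬ 8 ∣ n := by
  rintro ⟨k, hk⟩
  have hk0 : k ≠ 0 := by rintro rfl; exact NeZero.ne n (by rw [hk, mul_zero])
  have h0 : ((8 * k : ℕ) : ZMod n) = 0 := by rw [← hk, ZMod.natCast_self]
  push_cast at h0
  obtain ⟨δ, hδ⟩ : IsUnit (1 + 2 * k : ZMod n) :=
    IsNilpotent.isUnit_one_add ⟨3, by linear_combination (k : ZMod n) ^ 2 * h0⟩
  refine D.false_of_eight hψ hδ (by linear_combination h0) (fun h => ?_) fun a => ?_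
  · have h1 : ((4 * k : ℕ) : ZMod n) = 0 := by push_cast; linear_combination h
    rw [ZMod.natCast_eq_zero_iff, hk] at h1
    have := Nat.le_of_dvd (by omega) h1
    omega
  · have ha := ZMod.val_coe_unit_coprime a
    have hodd : Odd ((a : ZMod n).val : ℤ) := by
      rw [Int.odd_coe_nat]
      exact Nat.coprime_two_right.1 (ha.coprime_dvd_right ⟨4 * k, by rw [hk]; ring⟩)
    obtain ⟨j, hj⟩ := Int.eight_dvd_sq_sub_one_of_odd hodd
    have h1 := congrArg (Int.cast : ℤ → ZMod n) hj
    push_cast at h1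
    rw [ZMod.natCast_zmod_val] at h1
    rw [Units.val_pow_eq_pow_val]
    linear_combination 2 * (k : ZMod n) * h1 + 2 * (j : ZMod n) * h0

include D in
/-- The level is a divisor of four times an odd squarefree number. -/
theorem exists_level_eq [FiniteDimensional ℂ V] (hψ : Function.Injective ψ) :
    ∃ q m : ℕ, n = q * m ∧ q ∣ 4 ∧ Odd m ∧ Squarefree m ∧ q.Coprime m := by
  obtain ⟨k, m, hm, hn⟩ := Nat.exists_eq_two_pow_mul_odd (NeZero.ne n)
  refine ⟨2 ^ k, m, hn, ?_, hm, ?_, (Nat.coprime_two_left.2 hm).pow_left _⟩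
  · change 2 ^ k ∣ 2 ^ 2
    refine pow_dvd_pow 2 ?_
    by_contra h
    exact D.not_eight_dvd hψ (hn ▸ (pow_dvd_pow 2 (by omega : 3 ≤ k)).mul_right m)
  · rw [Nat.squarefree_iff_prime_squarefree]
    intro p hp hpm
    refine D.not_prime_sq_dvd hψ hp ?_ (hn ▸ hpm.mul_left _)
    rintro rfl
    exact Nat.not_even_iff_odd.2 hm (even_iff_two_dvd.2 ((Dvd.intro _ rfl).trans hpm))

end TorusCyclic

end LevelBounds

section Factor

variable {R B : Type*} [CommRing R] [CommRing B] (j : B →ₙ+* R)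

theorem factor_mul (x : B) : j 1 * j x = j x := by rw [← map_mul, one_mul]

/-- The image in `SL(2, R)` of a member of `SL(2, B)`, where `B` is a direct factor of `R`. -/
def factorMat (g : SL(2, B)) : SL(2, R) :=
  ⟨!![1 - j 1 + j (g.1 0 0), j (g.1 0 1); j (g.1 1 0), 1 - j 1 + j (g.1 1 1)], by
    have hg := congrArg j g.2
    rw [Matrix.det_fin_two, map_sub, map_mul, map_mul] at hg
    rw [Matrix.det_fin_two_of]
    linear_combination hg + factor_mul j 1 - factor_mul j (g.1 0 0) - factor_mul j (g.1 1 1)⟩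

theorem factorMat_val (g : SL(2, B)) : (factorMat j g).1 =
    !![1 - j 1 + j (g.1 0 0), j (g.1 0 1); j (g.1 1 0), 1 - j 1 + j (g.1 1 1)] := rfl

/-- The embedding of `SL(2, B)` into `SL(2, R)` attached to a direct factor `B` of `R`. -/
def factorHom : SL(2, B) →* SL(2, R) where
  toFun := factorMat j
  map_one' := by apply ext_entries <;> simp [factorMat_val]
  map_mul' g h := by
    apply ext_entries <;> simp only [mul_entry, factorMat_val, map_add, map_mul, Matrix.of_apply,
      Matrix.cons_val', Matrix.cons_val_zero, Matrix.cons_val_one, Matrix.cons_val_fin_one]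
    · linear_combination factor_mul j (g.1 0 0) + factor_mul j (h.1 0 0) - factor_mul j 1
    · linear_combination factor_mul j (h.1 0 1) + factor_mul j (g.1 0 1)
    · linear_combination factor_mul j (h.1 1 0) + factor_mul j (g.1 1 0)
    · linear_combination factor_mul j (g.1 1 1) + factor_mul j (h.1 1 1) - factor_mul j 1

theorem factorHom_val (g : SL(2, B)) : (factorHom j g).1 =
    !![1 - j 1 + j (g.1 0 0), j (g.1 0 1); j (g.1 1 0), 1 - j 1 + j (g.1 1 1)] := rfl

/-- The extension of a unit of a direct factor by one. -/
def factorUnit (b : Bˣ) : Rˣ where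
  val := 1 - j 1 + j b
  inv := 1 - j 1 + j (b⁻¹ : Bˣ)
  val_inv := by
    have h := congrArg j b.mul_inv
    rw [map_mul] at h
    linear_combination h + factor_mul j 1 - factor_mul j b - factor_mul j (b⁻¹ : Bˣ)
  inv_val := by
    have h := congrArg j b.mul_inv
    rw [map_mul] at h
    linear_combination h + factor_mul j 1 - factor_mul j b - factor_mul j (b⁻¹ : Bˣ)

theorem factorHom_tMat (x : B) : factorHom j (tMat x) = tMat (j x) := by
  apply ext_entries <;> simp [factorHom_val, tMat_val]

theorem factorHom_dMat (b : Bˣ) : factorHom j (dMat b) = dMat (factorUnit j b) := by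
  apply ext_entries <;> simp [factorHom_val, dMat_val] <;> rfl

theorem sMat_eq_factor : sMat R = factorHom j (sMat B) * (tMat (-(1 - j 1)) *
    (sMat R * tMat (-(1 - j 1)) * (sMat R)⁻¹) * tMat (-(1 - j 1))) := by
  have h := factor_mul j 1
  apply ext_entries <;> simp [mul_entry, factorHom_val, sMat_val, tMat_val]
  · linear_combination (1 - j 1) * h
  · linear_combination (-j 1 * (j 1 - 2)) * h
  · linear_combination (j 1 - 2) * h
  · linear_combination (1 - 3 * j 1 + j 1 * j 1) * h

namespace TorusCyclic

variable {ψ : AddChar R ℂ} {V : Type*} [AddCommGroup V]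
    [Module ℂ V] {ρ : SL(2, R) →* Module.End ℂ V} (D : TorusCyclic ψ ρ)

include D in
theorem T_complement {j : B →ₙ+* R} (hj : ∀ a : Rˣ, (1 - j 1) * ((a ^ 2 : Rˣ) : R) = 1 - j 1)
    (y : R) (w : V) : ρ (tMat (y * (1 - j 1))) w = ψ (y * (1 - j 1)) • w := by
  have : ρ (tMat (y * (1 - j 1))) = ψ (y * (1 - j 1)) • (LinearMap.id : V →ₗ[ℂ] V) :=
    D.hom_ext fun a => by
      rw [D.T_d, mul_assoc y, hj]
      rfl
  rw [this]
  rfl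

/-- Restriction of a torus-cyclic representation to a direct factor. -/
def restrict {j : B →ₙ+* R} (hinj : Function.Injective j)
    (hj : ∀ a : Rˣ, (1 - j 1) * ((a ^ 2 : Rˣ) : R) = 1 - j 1)
    (hsurj : ∀ y : R, ∃ b, y * j 1 = j b) :
    TorusCyclic (ψ.compAddMonoidHom (j : B →+ R)) (ρ.comp (factorHom j)) where
  v := D.v
  P := D.P
  T_v x := by
    rw [MonoidHom.comp_apply, factorHom_tMat, D.T_v]
    rfl
  P_T x w := by
    rw [MonoidHom.comp_apply, factorHom_tMat, D.P_T]
    rfl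
  P_v := D.P_v
  eig w hw := by
    refine D.eig w fun y => ?_
    obtain ⟨b, hb⟩ := hsurj y
    have hy : y = j b + y * (1 - j 1) := by rw [← hb]; ring
    have h := hw b
    rw [MonoidHom.comp_apply, factorHom_tMat] at h
    rw [hy, tMat_add, map_mul_apply, D.T_complement hj, map_smul, h, smul_smul,
      AddChar.map_add_eq_mul, mul_comm]
    rfl
  span_eq := by
    rw [eq_top_iff, ← D.span_eq, Submodule.span_le]
    rintro _ ⟨a, rfl⟩
    obtain ⟨b, hb⟩ := hsurj a
    obtain ⟨b', hb'⟩ := hsurj (a⁻¹ : Rˣ)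
    have hbb : b * b' = 1 := hinj <| by
      rw [map_mul, ← hb, ← hb']
      linear_combination j 1 * j 1 * a.mul_inv + factor_mul j 1
    let c : Bˣ := ⟨b, b', hbb, by rw [mul_comm, hbb]⟩
    have hc : ((factorUnit j c : Rˣ) : R) = 1 - j 1 + a * j 1 := by rw [hb]; rfl
    have hsq : factorUnit j c ^ 2 = a ^ 2 := Units.ext <| by
      have h := hj a
      rw [Units.val_pow_eq_pow_val] at h
      rw [Units.val_pow_eq_pow_val, Units.val_pow_eq_pow_val, hc]
      linear_combination (1 + (a : R) ^ 2 - 2 * a) * factor_mul j 1 - h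
    have hu : ((factorUnit j c)⁻¹ * a) ^ 2 = 1 := by rw [mul_pow, inv_pow, hsq, inv_mul_cancel]
    have h : ρ (dMat a) D.v =
        D.chi ((factorUnit j c)⁻¹ * a) • (ρ.comp (factorHom j)) (dMat c) D.v := by
      rw [MonoidHom.comp_apply, factorHom_dMat, ← map_smul]
      change _ = ρ _ (D.P _ • D.v)
      rw [← D.d_v_of_sq_eq_one _ hu, ← map_mul_apply, ← dMat_mul, mul_inv_cancel_left]
    change ρ (dMat a) D.v ∈ _
    rw [h]
    exact Submodule.smul_mem _ _ (Submodule.subset_span ⟨c, rfl⟩)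

end TorusCyclic

end Factor

/-- The second direct factor in the Chinese remainder theorem. -/
def crtInr {q m : ℕ} (h : q.Coprime m) : ZMod m →ₙ+* ZMod (q * m) where
  toFun x := (ZMod.chineseRemainder h).symm (0, x)
  map_zero' := map_zero (ZMod.chineseRemainder h).symm
  map_add' x y := by rw [← map_add, Prod.mk_add_mk, add_zero]
  map_mul' x y := by rw [← map_mul, Prod.mk_mul_mk, mul_zero]

theorem chineseRemainder_crtInr {q m : ℕ} (h : q.Coprime m) (x : ZMod m) :
    ZMod.chineseRemainder h (crtInr h x) = (0, x) := RingEquiv.apply_symm_apply _ _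

theorem crtInr_injective {q m : ℕ} (h : q.Coprime m) : Function.Injective (crtInr h) := by
  intro x y hxy
  have := congrArg (ZMod.chineseRemainder h) hxy
  rw [chineseRemainder_crtInr, chineseRemainder_crtInr] at this
  exact congrArg Prod.snd this

theorem exists_mul_crtInr_one {q m : ℕ} (h : q.Coprime m) (y : ZMod (q * m)) :
    ∃ b, y * crtInr h 1 = crtInr h b := by
  refine ⟨(ZMod.chineseRemainder h y).2, (ZMod.chineseRemainder h).injective ?_⟩
  rw [map_mul, chineseRemainder_crtInr, chineseRemainder_crtInr]
  ext <;> simp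

theorem unit_sq_eq_one {q : ℕ} (hq : q ∣ 4) (a : (ZMod q)ˣ) : a ^ 2 = 1 := by
  have : q ∈ Nat.divisors 4 := by simp [hq]
  have h : Nat.divisors 4 = {1, 2, 4} := by decide
  rw [h] at this
  simp only [Finset.mem_insert, Finset.mem_singleton] at this
  rcases this with rfl | rfl | rfl <;> revert a <;> decide

theorem one_sub_crtInr_mul_sq {q m : ℕ} (h : q.Coprime m) (hq : q ∣ 4) (a : (ZMod (q * m))ˣ) :
    (1 - crtInr h 1) * ((a ^ 2 : (ZMod (q * m))ˣ) : ZMod (q * m)) = 1 - crtInr h 1 := by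
  apply (ZMod.chineseRemainder h).injective
  rw [map_mul, map_sub, map_one, chineseRemainder_crtInr]
  have h1 := unit_sq_eq_one hq (Units.map ((RingHom.fst (ZMod q) (ZMod m)).comp
    (ZMod.chineseRemainder h).toRingHom).toMonoidHom a)
  rw [← map_pow] at h1
  ext
  · simpa using congrArg Units.val h1
  · simp

namespace TorusCyclic

variable {n : ℕ} [NeZero n] {ψ : AddChar (ZMod n) ℂ}
    {V V' : Type*} [AddCommGroup V] [Module ℂ V] [AddCommGroup V'] [Module ℂ V']
    {ρ : SL(2, ZMod n) →* Module.End ℂ V} {ρ' : SL(2, ZMod n) →* Module.End ℂ V'}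

theorem exists_equiv [FiniteDimensional ℂ V] [FiniteDimensional ℂ V']
    (D : TorusCyclic ψ ρ) (D' : TorusCyclic ψ ρ') (hψ : Function.Injective ψ) :
    ∃ e : V ≃ₗ[ℂ] V', (∀ w, e (ρ (tMat 1) w) = ρ' (tMat 1) (e w)) ∧
      ∀ w, e (ρ (sMat (ZMod n)) w) = ρ' (sMat (ZMod n)) (e w) := by
  obtain ⟨q, m, rfl, hq, hodd, hm, hc⟩ := D.exists_level_eq hψ
  have : NeZero m := ⟨hm.ne_zero⟩
  have hsq := one_sub_crtInr_mul_sq hc hq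
  obtain ⟨e, hT, hS⟩ := exists_equiv_of_odd_squarefree
    (D.restrict (crtInr_injective hc) hsq (exists_mul_crtInr_one hc))
    (D'.restrict (crtInr_injective hc) hsq (exists_mul_crtInr_one hc)) hodd hm
    (hψ.comp (crtInr_injective hc))
  have hf := D.T_complement hsq
  have hf' := D'.T_complement hsq
  have hneg : -(1 - crtInr hc 1) = -1 * (1 - crtInr hc 1) := (neg_one_mul _).symm
  have hcancel : ∀ w, ρ (sMat _) (ρ (sMat _)⁻¹ w) = w := fun w => by
    rw [← map_mul_apply, mul_inv_cancel, map_one, Module.End.one_apply]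
  have hcancel' : ∀ w, ρ' (sMat _) (ρ' (sMat _)⁻¹ w) = w := fun w => by
    rw [← map_mul_apply, mul_inv_cancel, map_one, Module.End.one_apply]
  refine ⟨e, fun w => ?_, fun w => ?_⟩
  · have h1 : (1 : ZMod (q * m)) = crtInr hc 1 + 1 * (1 - crtInr hc 1) := by ring
    have h2 := hT 1 w
    rw [MonoidHom.comp_apply, MonoidHom.comp_apply, factorHom_tMat] at h2
    rw [h1, tMat_add, map_mul_apply, map_mul_apply, hf, hf', map_smul, map_smul, map_smul, h2]
  · have h2 := hS w
    rw [MonoidHom.comp_apply, MonoidHom.comp_apply] at h2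
    rw [sMat_eq_factor (crtInr hc), hneg]
    simp only [map_mul_apply]
    rw [hf, hf', map_smul (ρ _), map_smul (ρ' _), hf, hf']
    simp only [map_smul]
    rw [hcancel, hcancel', hf, hf']
    simp only [map_smul]
    rw [h2]

end TorusCyclic

section Construction

variable {n : ℕ} {V : Type*} [AddCommGroup V] [Module ℂ V]

theorem tMat_one_pow (k : ℕ) : (tMat 1 : SL(2, ZMod n)) ^ k = tMat (k : ZMod n) := by
  induction k with
  | zero => rw [pow_zero, Nat.cast_zero, tMat_zero]
  | succ k ih => rw [pow_succ, ih, Nat.cast_succ, tMat_add]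

section Basis

variable [NeZero n] {ψ : AddChar (ZMod n) ℂ} {ρ : SL(2, ZMod n) →* Module.End ℂ V}
    (b : Module.Basis (Set.range fun a : (ZMod n)ˣ => a ^ 2) ℂ V)
    (hb : ∀ s, ρ (tMat 1) (b s) = ψ ((s : (ZMod n)ˣ) : ZMod n) • b s)

include hb in
theorem tMat_basis (x : ZMod n) (s : Set.range fun a : (ZMod n)ˣ => a ^ 2) :
    ρ (tMat x) (b s) = ψ (x * ((s : (ZMod n)ˣ) : ZMod n)) • b s := by
  rw [← ZMod.natCast_zmod_val x, ← tMat_one_pow, map_pow, ← nsmul_eq_mul, AddChar.map_nsmul_eq_pow]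
  induction x.val with
  | zero => simp
  | succ k ih => rw [pow_succ, Module.End.mul_apply, hb, map_smul, ih, smul_smul, pow_succ']

include hb in
theorem coord_tMat (x : ZMod n) (s : Set.range fun a : (ZMod n)ˣ => a ^ 2) (w : V) :
    b.coord s (ρ (tMat x) w) = ψ (x * ((s : (ZMod n)ˣ) : ZMod n)) * b.coord s w := by
  have : b.coord s ∘ₗ ρ (tMat x) = ψ (x * ((s : (ZMod n)ˣ) : ZMod n)) • b.coord s := by
    refine b.ext fun t => ?_
    simp only [LinearMap.comp_apply, LinearMap.smul_apply, tMat_basis b hb, map_smul]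
    by_cases h : t = s
    · rw [h]
    · rw [Module.Basis.coord_apply, Module.Basis.repr_self, Finsupp.single_eq_of_ne (Ne.symm h),
        smul_zero, smul_zero]
  exact LinearMap.congr_fun this w

include hb in
theorem eq_coord_smul (hψ : Function.Injective ψ) (s : Set.range fun a : (ZMod n)ˣ => a ^ 2)
    {w : V} (hw : ρ (tMat 1) w = ψ ((s : (ZMod n)ˣ) : ZMod n) • w) :
    w = b.coord s w • b s := by
  refine b.ext_elem fun t => ?_
  rw [map_smul, Finsupp.smul_apply, Module.Basis.repr_self]
  by_cases h : t = s
  · rw [h, Finsupp.single_eq_same, smul_eq_mul, mul_one, Module.Basis.coord_apply]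
  · rw [Finsupp.single_eq_of_ne h, smul_zero]
    have h1 := coord_tMat b hb 1 t w
    rw [hw, map_smul, smul_eq_mul, one_mul] at h1
    by_contra h0
    exact h (Subtype.ext (Units.ext (hψ (mul_right_cancel₀ h0 h1)).symm))

/-- A representation with a basis of eigenvectors of `T`, whose eigenvalues are indexed by the
squares of units, is torus-cyclic. -/
noncomputable def torusCyclicOfBasis (hψ : Function.Injective ψ) : TorusCyclic ψ ρ where
  v := b ⟨1, 1, one_pow 2⟩
  P := b.coord ⟨1, 1, one_pow 2⟩
  T_v x := by rw [tMat_basis b hb, Units.val_one, mul_one]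
  P_T x w := by rw [coord_tMat b hb, Units.val_one, mul_one]
  P_v := by rw [Module.Basis.coord_apply, Module.Basis.repr_self, Finsupp.single_eq_same]
  eig w hw := eq_coord_smul b hb hψ _ (hw 1)
  span_eq := by
    rw [eq_top_iff, ← b.span_eq, Submodule.span_le]
    rintro _ ⟨⟨_, a, rfl⟩, rfl⟩
    set v := b ⟨1, 1, one_pow 2⟩ with hv
    have hT : ρ (tMat 1) (ρ (dMat a⁻¹) v) = ψ ((a ^ 2 : (ZMod n)ˣ) : ZMod n) • ρ (dMat a⁻¹) v := by
      rw [← TorusCyclic.map_mul_apply, tMat_mul_dMat, TorusCyclic.map_mul_apply, hv,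
        tMat_basis b hb, map_smul, inv_inv, Units.val_one, one_mul, mul_one]
    have h := eq_coord_smul b hb hψ ⟨a ^ 2, a, rfl⟩ hT
    have h0 : ρ (dMat a⁻¹) v ≠ 0 := fun h0 => b.ne_zero ⟨1, 1, one_pow 2⟩ <| by
      rw [← hv, ← Module.End.one_apply (R := ℂ) v, ← map_one ρ, ← dMat_one, ← mul_inv_cancel a,
        dMat_mul, TorusCyclic.map_mul_apply, h0, map_zero]
    have hc : b.coord ⟨a ^ 2, a, rfl⟩ (ρ (dMat a⁻¹) v) ≠ 0 := fun hc => h0 <| by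
      rw [h, hc, zero_smul]
    have hmem : ρ (dMat a⁻¹) v ∈
        Submodule.span ℂ (Set.range fun a : (ZMod n)ˣ => ρ (dMat a) v) :=
      Submodule.subset_span ⟨a⁻¹, rfl⟩
    rw [h] at hmem
    exact (Submodule.smul_mem_iff _ hc).1 hmem

end Basis

/-- The additive character of `ZMod n` attached to a primitive root of unity is injective. -/
theorem zmodChar_injective [NeZero n] {ζ : ℂ} (hζ : IsPrimitiveRoot ζ n) :
    Function.Injective (AddChar.zmodChar n hζ.pow_eq_one) := by
  intro x y h
  rw [AddChar.zmodChar_apply, AddChar.zmodChar_apply] at h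
  exact ZMod.val_injective n (hζ.pow_inj (ZMod.val_lt x) (ZMod.val_lt y) h)

theorem exists_torusCyclic [NeZero n] [FiniteDimensional ℂ V] {ζ : ℂ} (hζ : IsPrimitiveRoot ζ n)
    (ρ : SL(2, ℤ) →* (Module.End ℂ V)ˣ) (hker : CongruenceSubgroup.Gamma n ≤ ρ.ker)
    (hdim : Module.finrank ℂ V = phi2 n)
    (hspec : ∀ a : ℤ, IsCoprime a (n : ℤ) → ∃ x : V, x ≠ 0 ∧
      (ρ ModularGroup.T : Module.End ℂ V) x = ζ ^ (a ^ 2) • x) :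
    ∃ ρ' : SL(2, ZMod n) →* Module.End ℂ V, (∀ g, ρ' (slMod n g) = ρ g) ∧
      Nonempty (TorusCyclic (AddChar.zmodChar n hζ.pow_eq_one) ρ') := by
  classical
  let σ := (slMod n).liftOfSurjective (map_surjective n) ⟨ρ, hker⟩
  let ρ' : SL(2, ZMod n) →* Module.End ℂ V := (Units.coeHom _).comp σ
  have hσ : ∀ g, ρ' (slMod n g) = ρ g := fun g => congrArg Units.val <|
    MonoidHom.liftOfRightInverse_comp_apply (slMod n) _ _ ⟨ρ, hker⟩ g
  refine ⟨ρ', hσ, ?_⟩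
  set ψ := AddChar.zmodChar n hζ.pow_eq_one with hψ
  have hx : ∀ s : Set.range fun a : (ZMod n)ˣ => a ^ 2,
      ∃ x : V, (ρ' (tMat 1)).HasEigenvector (ψ ((s : (ZMod n)ˣ) : ZMod n)) x := by
    rintro ⟨_, a, rfl⟩
    obtain ⟨x, hx0, hx⟩ := hspec ((a : ZMod n).val : ℤ)
      (Nat.isCoprime_iff_coprime.2 (ZMod.val_coe_unit_coprime a))
    refine ⟨x, Module.End.mem_eigenspace_iff.2 ?_, hx0⟩
    have h1 : ψ ((a ^ 2 : (ZMod n)ˣ) : ZMod n) = ζ ^ (((a : ZMod n).val : ℤ) ^ 2) := by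
      rw [Units.val_pow_eq_pow_val, ← ZMod.natCast_zmod_val (a : ZMod n), ← Nat.cast_pow, hψ,
        AddChar.zmodChar_apply', ZMod.natCast_zmod_val, ← Nat.cast_pow, zpow_natCast]
    rw [← map_T n, hσ]
    change _ = ψ ((a ^ 2 : (ZMod n)ˣ) : ZMod n) • x
    rw [h1]
    exact hx
  choose x hx using hx
  have hli := Module.End.eigenvectors_linearIndependent' (ρ' (tMat 1))
    (fun s : Set.range fun a : (ZMod n)ˣ => a ^ 2 => ψ ((s : (ZMod n)ˣ) : ZMod n))
    (fun s t h => Subtype.ext (Units.ext (zmodChar_injective hζ h))) x hx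
  have : Nonempty (Set.range fun a : (ZMod n)ˣ => a ^ 2) := ⟨⟨1, 1, one_pow 2⟩⟩
  have hcard : Fintype.card (Set.range fun a : (ZMod n)ˣ => a ^ 2) = Module.finrank ℂ V := by
    rw [hdim, phi2, Nat.card_eq_fintype_card]
  refine ⟨torusCyclicOfBasis (basisOfLinearIndependentOfCardEqFinrank hli hcard)
    (fun s => ?_) (zmodChar_injective hζ)⟩
  rw [coe_basisOfLinearIndependentOfCardEqFinrank]
  exact (hx s).apply_eq_smul

end Construction

end SLTwo

/-- Two minimal irreducible level-`n` representations of `SL(2,ℤ)` with the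
same primitive `n`-th root of unity `ζ` realizing their `T`-spectrum `{ζ^(a²) : gcd(a,n)=1}`
are equivalent. -/
theorem minimal_irreducible_unique
    (n : ℕ) (hn : 1 ≤ n) (ζ : ℂ) (hζ : IsPrimitiveRoot ζ n)
    (V₁ V₂ : Type*) [AddCommGroup V₁] [Module ℂ V₁] [FiniteDimensional ℂ V₁]
    [AddCommGroup V₂] [Module ℂ V₂] [FiniteDimensional ℂ V₂]
    (ρ₁ : Matrix.SpecialLinearGroup (Fin 2) ℤ →* (V₁ →ₗ[ℂ] V₁)ˣ)
    (ρ₂ : Matrix.SpecialLinearGroup (Fin 2) ℤ →* (V₂ →ₗ[ℂ] V₂)ˣ)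
    (hker₁ : CongruenceSubgroup.Gamma n ≤ ρ₁.ker)
    (hker₂ : CongruenceSubgroup.Gamma n ≤ ρ₂.ker)
    (hirr₁ : ∀ U : Submodule ℂ V₁,
      (∀ g : Matrix.SpecialLinearGroup (Fin 2) ℤ, ∀ x ∈ U, (ρ₁ g : V₁ →ₗ[ℂ] V₁) x ∈ U) →
      U = ⊥ ∨ U = ⊤)
    (hirr₂ : ∀ U : Submodule ℂ V₂,
      (∀ g : Matrix.SpecialLinearGroup (Fin 2) ℤ, ∀ x ∈ U, (ρ₂ g : V₂ →ₗ[ℂ] V₂) x ∈ U) →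
      U = ⊥ ∨ U = ⊤)
    (horder₁ : orderOf (ρ₁ ModularGroup.T) = n)
    (horder₂ : orderOf (ρ₂ ModularGroup.T) = n)
    (hdim₁ : Module.finrank ℂ V₁ = phi2 n)
    (hdim₂ : Module.finrank ℂ V₂ = phi2 n)
    (hspec₁ : {μ : ℂ | ∃ x : V₁, x ≠ 0 ∧ (ρ₁ ModularGroup.T : V₁ →ₗ[ℂ] V₁) x = μ • x}
      = {μ : ℂ | ∃ a : ℤ, IsCoprime a (n : ℤ) ∧ μ = ζ ^ (a ^ 2)})
    (hspec₂ : {μ : ℂ | ∃ x : V₂, x ≠ 0 ∧ (ρ₂ ModularGroup.T : V₂ →ₗ[ℂ] V₂) x = μ • x}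
      = {μ : ℂ | ∃ a : ℤ, IsCoprime a (n : ℤ) ∧ μ = ζ ^ (a ^ 2)}) :
    ∃ e : V₁ ≃ₗ[ℂ] V₂, ∀ (g : Matrix.SpecialLinearGroup (Fin 2) ℤ) (x : V₁),
      e ((ρ₁ g : V₁ →ₗ[ℂ] V₁) x) = (ρ₂ g : V₂ →ₗ[ℂ] V₂) (e x) := by
  have : NeZero n := ⟨Nat.one_le_iff_ne_zero.1 hn⟩
  obtain ⟨σ₁, hσ₁, ⟨D₁⟩⟩ := SLTwo.exists_torusCyclic hζ ρ₁ hker₁ hdim₁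
    fun a ha => hspec₁.symm.subset ⟨a, ha, rfl⟩
  obtain ⟨σ₂, hσ₂, ⟨D₂⟩⟩ := SLTwo.exists_torusCyclic hζ ρ₂ hker₂ hdim₂
    fun a ha => hspec₂.symm.subset ⟨a, ha, rfl⟩
  obtain ⟨e, hT, hS⟩ := D₁.exists_equiv D₂ (SLTwo.zmodChar_injective hζ)
  refine ⟨e, fun g => ?_⟩
  have hg : g ∈ Subgroup.closure {ModularGroup.S, ModularGroup.T} := by
    rw [SpecialLinearGroup.SL2Z_generators]
    exact Subgroup.mem_top g
  induction hg using Subgroup.closure_induction with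
  | mem g hg =>
    intro x
    rw [← hσ₁, ← hσ₂]
    rcases hg with rfl | rfl
    · rw [SLTwo.map_S]
      exact hS x
    · rw [SLTwo.map_T]
      exact hT x
  | one => simp
  | mul g h _ _ ihg ihh =>
    intro x
    rw [map_mul, map_mul, Units.val_mul, Units.val_mul, Module.End.mul_apply,
      Module.End.mul_apply, ihg, ihh]
  | inv g _ ih =>
    intro x
    have h₁ : (ρ₁ g : V₁ →ₗ[ℂ] V₁) ((ρ₁ g⁻¹ : V₁ →ₗ[ℂ] V₁) x) = x := by
      rw [← Module.End.mul_apply, ← Units.val_mul, ← map_mul, mul_inv_cancel, map_one,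
        Units.val_one, Module.End.one_apply]
    have h₂ (y : V₂) : (ρ₂ g⁻¹ : V₂ →ₗ[ℂ] V₂) ((ρ₂ g : V₂ →ₗ[ℂ] V₂) y) = y := by
      rw [← Module.End.mul_apply, ← Units.val_mul, ← map_mul, inv_mul_cancel, map_one,
        Units.val_one, Module.End.one_apply]
    rw [← h₂ (e _), ← ih, h₁]
end
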